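/- arXiv:0910.4467 — 4 statements merged into one kernel-verified Lean document; each statement's English description precedes it below -/
import Mathlib

section
/- There is a numerical constant C (independent of n, S and ν) such that for every n ≥ 1, S > 0, ν ∈ B_{n,S} and all u, v ∈ ℝ, |K̃_{n,S}^ν(u,v)| ≤ C·(S·A(ν))^{-1/2}·exp(3u²/(S·A(ν))). -/
open scoped Real BigOperators
open MeasureTheory

/-- The kernel `K̃_{n,S}^ν(u,v)`, written as an iterated integral over the
parametrized contours `γ = γ₊ + γ₋` (with `γ₊ : t ↦ −t + ib`, `γ₋ : t ↦ t − ib`)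
for the outer `z`-integral, and `Γ₀ : s ↦ is` for the inner `w`-integral:
`K̃(u,v) = (1/(2πi)²) ∫_γ dz ∫_{Γ₀} dw e^{uz−vw}(w−z)⁻¹ e^{S(w²−z²)/2 + SD(ν)(w−z)}
· Πⱼ (Sw−νⱼ)/(Sz−νⱼ)`, where `D(ν) = ∑ⱼ νⱼ/(νⱼ² + b²S²)`. -/
noncomputable def Ktilde (n : ℕ) (S : ℝ) (ν : Fin n → ℝ) (b : ℝ) (u v : ℝ) : ℂ :=
  let Dν : ℝ := ∑ j, ν j / ((ν j) ^ 2 + b ^ 2 * S ^ 2)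
  let F : ℂ → ℂ → ℂ := fun z w =>
    Complex.exp ((u : ℂ) * z - (v : ℂ) * w) / (w - z) *
      Complex.exp ((S : ℂ) * (w ^ 2 - z ^ 2) / 2 + (S : ℂ) * (Dν : ℂ) * (w - z)) *
      ∏ j, ((S : ℂ) * w - (ν j : ℂ)) / ((S : ℂ) * z - (ν j : ℂ))
  ((2 * (π : ℂ) * Complex.I) ^ 2)⁻¹ *
    ((∫ t : ℝ, (∫ s : ℝ, F (-(t : ℂ) + (b : ℂ) * Complex.I) ((s : ℂ) * Complex.I)
        * Complex.I) * (-1)) +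
     (∫ t : ℝ, ∫ s : ℝ, F ((t : ℂ) - (b : ℂ) * Complex.I) ((s : ℂ) * Complex.I)
        * Complex.I))

theorem sqrt_one_add_le_exp {p r : ℝ} (hp : 0 < p) (hp1 : p ≤ 1) (hr : 0 ≤ r) :
    √(1 + p * (r ^ 2 - 1)) ≤ Real.exp (p * (r ^ 2 - 1) / 2 - p ^ 2 * (r - 1) ^ 2 / 4) := by
  have hx : 0 ≤ 1 + p * (r ^ 2 - 1) := by nlinarith [mul_nonneg hp.le (sq_nonneg r)]
  rcases hx.eq_or_lt with h0 | hpos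
  · rw [← h0, Real.sqrt_zero]; positivity
  have key : Real.log (1 + p * (r ^ 2 - 1)) ≤ p * (r ^ 2 - 1) - p ^ 2 * (r - 1) ^ 2 / 2 := by
    rcases le_total 1 r with h1 | h1
    · have hX : 1 ≤ 1 + p * (r ^ 2 - 1) := by
        nlinarith [mul_nonneg hp.le (by nlinarith : 0 ≤ r ^ 2 - 1)]
      have h2 : Real.log (1 + p * (r ^ 2 - 1)) ≤
          ((1 + p * (r ^ 2 - 1)) - (1 + p * (r ^ 2 - 1))⁻¹) / 2 := by
        rw [← Real.sinh_log hpos]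
        exact Real.self_le_sinh_iff.2 (Real.log_nonneg hX)
      refine h2.trans ?_
      have h3 : p ^ 2 * (r - 1) ^ 2 * (1 + p * (r ^ 2 - 1)) ≤ (p * (r ^ 2 - 1)) ^ 2 := by
        have : 1 + p * (r ^ 2 - 1) ≤ (r + 1) ^ 2 := by
          nlinarith [mul_nonneg (sub_nonneg.2 hp1) (by nlinarith : 0 ≤ r ^ 2 - 1)]
        calc p ^ 2 * (r - 1) ^ 2 * (1 + p * (r ^ 2 - 1))
            ≤ p ^ 2 * (r - 1) ^ 2 * (r + 1) ^ 2 := by gcongr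
          _ = _ := by ring
      generalize p * (r ^ 2 - 1) = x at *
      have h4 : p ^ 2 * (r - 1) ^ 2 ≤ x ^ 2 / (1 + x) := by rwa [le_div_iff₀ hpos]
      have h5 : ((1 + x) - (1 + x)⁻¹) / 2 = x - (x ^ 2 / (1 + x)) / 2 := by field_simp; ring
      rw [h5]; linarith
    · set y := p * (1 - r ^ 2) with hy
      have hy0 : 0 ≤ y := mul_nonneg hp.le (by nlinarith)
      have e : 1 + p * (r ^ 2 - 1) = 1 - y := by rw [hy]; ring
      have hy1 : |y| < 1 := by rw [abs_of_nonneg hy0]; linarith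
      have hs := Real.hasSum_pow_div_log_of_abs_lt_one hy1
      have h2 := sum_le_hasSum (Finset.range 2) (fun i _ => by positivity) hs
      simp only [Finset.sum_range_succ, Finset.sum_range_zero] at h2
      norm_num at h2
      have h3 : p ^ 2 * (r - 1) ^ 2 ≤ y ^ 2 := by
        have : (1:ℝ) ≤ (1 + r) ^ 2 := by nlinarith
        calc p ^ 2 * (r - 1) ^ 2 = p ^ 2 * (r - 1) ^ 2 * 1 := by ring
          _ ≤ p ^ 2 * (r - 1) ^ 2 * (1 + r) ^ 2 := by gcongr
          _ = y ^ 2 := by rw [hy]; ring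
      rw [e]
      have : p * (r ^ 2 - 1) = - y := by rw [hy]; ring
      rw [this]; linarith
  rw [Real.sqrt_le_left (by positivity), ← Real.exp_nat_mul, ← Real.log_le_iff_le_exp hpos]
  refine key.trans (le_of_eq ?_)
  push_cast; ring

theorem vertical_factor_le {S b : ℝ} (hS : 0 < S) (hb : 0 < b) (x s : ℝ) :
    Real.exp (S ^ 2 / (x ^ 2 + b ^ 2 * S ^ 2) * ((b ^ 2 - s ^ 2) / 2)) * √(x ^ 2 + S ^ 2 * s ^ 2) ≤
      √(x ^ 2 + b ^ 2 * S ^ 2) *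
        Real.exp (S ^ 4 * b ^ 2 / (x ^ 2 + b ^ 2 * S ^ 2) ^ 2 * (-(|s| - b) ^ 2 / 4)) := by
  set c := x ^ 2 + b ^ 2 * S ^ 2 with hc
  have hc0 : 0 < c := by positivity
  have h := sqrt_one_add_le_exp (p := b ^ 2 * S ^ 2 / c) (r := |s| / b) (by positivity)
    (by rw [div_le_one hc0, hc]; nlinarith [sq_nonneg x]) (by positivity)
  have e1 : b ^ 2 * S ^ 2 / c * ((|s| / b) ^ 2 - 1) = S ^ 2 / c * (s ^ 2 - b ^ 2) := by
    rw [div_pow, sq_abs]; field_simp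
  have e2 : (b ^ 2 * S ^ 2 / c) ^ 2 * (|s| / b - 1) ^ 2 / 4 =
      S ^ 4 * b ^ 2 / c ^ 2 * ((|s| - b) ^ 2 / 4) := by field_simp
  have e3 : x ^ 2 + S ^ 2 * s ^ 2 = c * (1 + S ^ 2 / c * (s ^ 2 - b ^ 2)) := by
    field_simp; rw [hc]; ring
  rw [e1, e2] at h
  rw [e3, Real.sqrt_mul hc0.le]
  calc _ ≤ Real.exp (S ^ 2 / c * ((b ^ 2 - s ^ 2) / 2)) * (√c * Real.exp
        (S ^ 2 / c * (s ^ 2 - b ^ 2) / 2 - S ^ 4 * b ^ 2 / c ^ 2 * ((|s| - b) ^ 2 / 4))) := by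
        gcongr
    _ = √c * (Real.exp (S ^ 2 / c * ((b ^ 2 - s ^ 2) / 2)) * Real.exp
        (S ^ 2 / c * (s ^ 2 - b ^ 2) / 2 - S ^ 4 * b ^ 2 / c ^ 2 * ((|s| - b) ^ 2 / 4))) := by
        ring
    _ = _ := by rw [← Real.exp_add]; congr 2; ring

/-- Along the hyperbola `Im² = 1 + Re² / 3` the phase of a single factor is controlled by a
quadratic; here `x` is the real part and `a` the pole. -/
theorem hyperbola_phase_le_of_nonneg (a : ℝ) {x : ℝ} (hx : 0 ≤ x) :
    2 / 3 * x ^ 2 / (1 + a ^ 2) ^ 2 ≤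
      (2 / 3 * x ^ 2 + 2 * a * x) / (1 + a ^ 2) +
        Real.log (1 + (4 / 3 * x ^ 2 - 2 * a * x) / (1 + a ^ 2)) := by
  have hq : ∀ x : ℝ, 0 < (1 + a ^ 2) + (4 / 3 * x ^ 2 - 2 * a * x) := fun x => by
    nlinarith [sq_nonneg (a - x), sq_nonneg x]
  have hq' : ∀ x : ℝ, 0 < 1 + (4 / 3 * x ^ 2 - 2 * a * x) / (1 + a ^ 2) := fun x => by
    have : 1 + (4 / 3 * x ^ 2 - 2 * a * x) / (1 + a ^ 2) =
      ((1 + a ^ 2) + (4 / 3 * x ^ 2 - 2 * a * x)) / (1 + a ^ 2) := by field_simp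
    rw [this]; exact div_pos (hq x) (by positivity)
  let f : ℝ → ℝ := fun x => (2 / 3 * x ^ 2 + 2 * a * x) / (1 + a ^ 2) +
        Real.log (1 + (4 / 3 * x ^ 2 - 2 * a * x) / (1 + a ^ 2)) -
        2 / 3 * x ^ 2 / (1 + a ^ 2) ^ 2
  have hd : ∀ x : ℝ, HasDerivAt f ((4 / 3 * x + 2 * a) / (1 + a ^ 2) +
      ((8 / 3 * x - 2 * a) / (1 + a ^ 2)) / (1 + (4 / 3 * x ^ 2 - 2 * a * x) / (1 + a ^ 2)) -
      4 / 3 * x / (1 + a ^ 2) ^ 2) x := fun x => by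
    have h2 : HasDerivAt (fun x : ℝ => x ^ 2) (2 * x) x := by simpa using hasDerivAt_pow 2 x
    have h1 : HasDerivAt (fun x : ℝ => 2 * a * x) (2 * a) x := by
      simpa using (hasDerivAt_id x).const_mul (2 * a)
    refine HasDerivAt.congr_deriv (((((h2.const_mul (2 / 3)).add h1).div_const (1 + a ^ 2)).add
      ((((((h2.const_mul (4 / 3)).sub h1).div_const (1 + a ^ 2)).const_add 1)).log
        (hq' x).ne')).sub (((h2.const_mul (2 / 3)).div_const ((1 + a ^ 2) ^ 2)))) ?_
    simp only [Pi.sub_apply]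
    ring
  have hmono : MonotoneOn f (Set.Ici 0) := by
    refine monotoneOn_of_deriv_nonneg (convex_Ici 0)
      (fun x _ => (hd x).continuousAt.continuousWithinAt)
      (fun x _ => (hd x).differentiableAt.differentiableWithinAt) fun x hx => ?_
    rw [interior_Ici, Set.mem_Ioi] at hx
    rw [(hd x).deriv]
    have e : (4 / 3 * x + 2 * a) / (1 + a ^ 2) +
      ((8 / 3 * x - 2 * a) / (1 + a ^ 2)) / (1 + (4 / 3 * x ^ 2 - 2 * a * x) / (1 + a ^ 2)) -
      4 / 3 * x / (1 + a ^ 2) ^ 2 =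
      4 / 3 * x * (2 * (1 + a ^ 2) + 4 / 3 * x ^ 2 * a ^ 2 + 2 * a * x) /
        ((1 + a ^ 2) ^ 2 * ((1 + a ^ 2) + (4 / 3 * x ^ 2 - 2 * a * x))) := by
      have h1 := (hq x).ne'
      have h2 : 1 + (4 / 3 * x ^ 2 - 2 * a * x) / (1 + a ^ 2) =
        ((1 + a ^ 2) + (4 / 3 * x ^ 2 - 2 * a * x)) / (1 + a ^ 2) := by field_simp
      have h3 : (1 + a ^ 2) ≠ 0 := by positivity
      rw [h2]
      generalize hX : (1 + a ^ 2) + (4 / 3 * x ^ 2 - 2 * a * x) = X at *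
      field_simp
      rw [← hX]; ring
    rw [e]
    have h1 := hq x
    have h2 : 0 ≤ 2 * (1 + a ^ 2) + 4 / 3 * x ^ 2 * a ^ 2 + 2 * a * x := by
      nlinarith [sq_nonneg (a * x + 1), sq_nonneg a, sq_nonneg (a * x)]
    positivity
  have := hmono (Set.mem_Ici.2 le_rfl) (Set.mem_Ici.2 hx) hx
  simp only [f] at this
  norm_num at this
  linarith

theorem hyperbola_phase_le (a x : ℝ) :
    2 / 3 * x ^ 2 / (1 + a ^ 2) ^ 2 ≤
      (2 / 3 * x ^ 2 + 2 * a * x) / (1 + a ^ 2) +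
        Real.log (1 + (4 / 3 * x ^ 2 - 2 * a * x) / (1 + a ^ 2)) := by
  rcases le_total 0 x with h | h
  · exact hyperbola_phase_le_of_nonneg a h
  · simpa using hyperbola_phase_le_of_nonneg (-a) (neg_nonneg.2 h)

theorem hyperbola_factor_le {S b : ℝ} (hS : 0 < S) (hb : 0 < b) (x t : ℝ) :
    Real.exp (S ^ 2 / (x ^ 2 + b ^ 2 * S ^ 2) * (-t ^ 2 / 3) +
        x / (x ^ 2 + b ^ 2 * S ^ 2) * (-S * t)) * √(x ^ 2 + b ^ 2 * S ^ 2) ≤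
      Real.exp (S ^ 4 * b ^ 2 / (x ^ 2 + b ^ 2 * S ^ 2) ^ 2 * (-t ^ 2 / 3)) *
        √((S * t - x) ^ 2 + S ^ 2 * (b ^ 2 + t ^ 2 / 3)) := by
  set c := x ^ 2 + b ^ 2 * S ^ 2 with hc
  have hc0 : 0 < c := by positivity
  have h := hyperbola_phase_le (x / (b * S)) (t / b)
  have e0 : 1 + (x / (b * S)) ^ 2 = c / (b * S) ^ 2 := by rw [hc]; field_simp; ring
  have e1 : (4 / 3 * (t / b) ^ 2 - 2 * (x / (b * S)) * (t / b)) / (c / (b * S) ^ 2) =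
      (4 / 3 * S ^ 2 * t ^ 2 - 2 * S * x * t) / c := by field_simp
  have e2 : (2 / 3 * (t / b) ^ 2 + 2 * (x / (b * S)) * (t / b)) / (c / (b * S) ^ 2) =
      -2 * (S ^ 2 / c * (-t ^ 2 / 3) + x / c * (-S * t)) := by field_simp; ring
  have e3 : 2 / 3 * (t / b) ^ 2 / (c / (b * S) ^ 2) ^ 2 =
      -2 * (S ^ 4 * b ^ 2 / c ^ 2 * (-t ^ 2 / 3)) := by field_simp
  have e4 : (S * t - x) ^ 2 + S ^ 2 * (b ^ 2 + t ^ 2 / 3) =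
      c * (1 + (4 / 3 * S ^ 2 * t ^ 2 - 2 * S * x * t) / c) := by field_simp; rw [hc]; ring
  have h0 : 0 < (S * t - x) ^ 2 + S ^ 2 * (b ^ 2 + t ^ 2 / 3) := by positivity
  rw [e0, e1, e2, e3] at h
  rw [e4] at h0
  rw [e4, Real.sqrt_mul hc0.le]
  have hX : 0 < 1 + (4 / 3 * S ^ 2 * t ^ 2 - 2 * S * x * t) / c := pos_of_mul_pos_right h0 hc0.le
  generalize 1 + (4 / 3 * S ^ 2 * t ^ 2 - 2 * S * x * t) / c = X at *
  generalize S ^ 2 / c * (-t ^ 2 / 3) + x / c * (-S * t) = P at *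
  generalize S ^ 4 * b ^ 2 / c ^ 2 * (-t ^ 2 / 3) = Q at *
  have hsq : √X = Real.exp (Real.log X / 2) := by
    rw [← Real.log_sqrt hX.le, Real.exp_log (Real.sqrt_pos.2 hX)]
  rw [hsq]
  calc Real.exp P * √c ≤ Real.exp (Q + Real.log X / 2) * √c := by gcongr; linarith
    _ = _ := by rw [Real.exp_add]; ring

/-- The double contour integrand of `Ktilde`. -/
noncomputable def kernelIntegrand (n : ℕ) (S : ℝ) (ν : Fin n → ℝ) (D u v : ℝ) (z w : ℂ) : ℂ :=
  Complex.exp ((u : ℂ) * z - (v : ℂ) * w) / (w - z) *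
    Complex.exp ((S : ℂ) * (w ^ 2 - z ^ 2) / 2 + (S : ℂ) * (D : ℂ) * (w - z)) *
    ∏ j, ((S : ℂ) * w - (ν j : ℂ)) / ((S : ℂ) * z - (ν j : ℂ))

theorem kernelIntegrand_conj (n : ℕ) (S : ℝ) (ν : Fin n → ℝ) (D u v : ℝ) (z w : ℂ) :
    kernelIntegrand n S ν D u v (starRingEnd ℂ z) (starRingEnd ℂ w) =
      starRingEnd ℂ (kernelIntegrand n S ν D u v z w) := by
  simp [kernelIntegrand, ← Complex.exp_conj, map_ofNat]

theorem norm_kernelIntegrand (n : ℕ) (S : ℝ) (ν : Fin n → ℝ) (D u v t y s : ℝ) :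
    ‖kernelIntegrand n S ν D u v ((t : ℂ) + (y : ℂ) * Complex.I) ((s : ℂ) * Complex.I)‖ =
      Real.exp (u * t) / ‖(s : ℂ) * Complex.I - ((t : ℂ) + (y : ℂ) * Complex.I)‖ *
        Real.exp (S * (y ^ 2 - s ^ 2 - t ^ 2) / 2 - S * D * t) *
        ((∏ j, √(ν j ^ 2 + S ^ 2 * s ^ 2)) / ∏ j, √((S * t - ν j) ^ 2 + S ^ 2 * y ^ 2)) := by
  have h1 : ∀ j, ‖(S : ℂ) * ((s : ℂ) * Complex.I) - (ν j : ℂ)‖ = √(ν j ^ 2 + S ^ 2 * s ^ 2) := by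
    intro j
    rw [Complex.norm_eq_sqrt_sq_add_sq]
    congr 1
    simp; ring
  have h2 : ∀ j, ‖(S : ℂ) * ((t : ℂ) + (y : ℂ) * Complex.I) - (ν j : ℂ)‖ =
      √((S * t - ν j) ^ 2 + S ^ 2 * y ^ 2) := by
    intro j
    rw [Complex.norm_eq_sqrt_sq_add_sq]
    congr 1
    simp; ring
  simp only [kernelIntegrand, norm_mul, norm_div, norm_prod, Complex.norm_exp, h1, h2,
    Finset.prod_div_distrib]
  congr 3
  · congr 1; simp
  · simp [pow_two]; ring

theorem abs_rpow_half_mul_le_norm {b t y s : ℝ} (hb : 0 < b) (hy : b ≤ y)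
    (hy' : y ≤ √(b ^ 2 + t ^ 2 / 3)) :
    |t| ^ (1 / 2 : ℝ) * |s - b| ^ (1 / 2 : ℝ) ≤
      ‖(s : ℂ) * Complex.I - ((t : ℂ) + (y : ℂ) * Complex.I)‖ := by
  have e : ‖(s : ℂ) * Complex.I - ((t : ℂ) + (y : ℂ) * Complex.I)‖ = √(t ^ 2 + (s - y) ^ 2) := by
    rw [Complex.norm_eq_sqrt_sq_add_sq]; congr 1; simp
  have h2 : y ^ 2 ≤ b ^ 2 + t ^ 2 / 3 := by
    have := Real.sq_sqrt (by positivity : 0 ≤ b ^ 2 + t ^ 2 / 3)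
    nlinarith
  have h3 : (y - b) ^ 2 ≤ t ^ 2 / 3 := by nlinarith
  rw [e, ← Real.mul_rpow (abs_nonneg _) (abs_nonneg _), ← Real.sqrt_eq_rpow]
  apply Real.sqrt_le_sqrt
  have h4 : 2 * (|t| * |s - b|) ≤ t ^ 2 + (s - b) ^ 2 := by
    nlinarith [sq_nonneg (|t| - |s - b|), sq_abs t, sq_abs (s - b)]
  nlinarith [sq_nonneg ((s - y) - (y - b))]

/-- A Gaussian with an integrable singularity at the origin. -/
noncomputable def singularGaussian (β x : ℝ) : ℝ :=
  |x| ^ (-(1 / 2) : ℝ) * Real.exp (-β / 4 * x ^ 2)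

theorem singularGaussian_nonneg (β x : ℝ) : 0 ≤ singularGaussian β x := by
  unfold singularGaussian; positivity

theorem singularGaussian_neg (β x : ℝ) : singularGaussian β (-x) = singularGaussian β x := by
  simp [singularGaussian]

theorem integrable_singularGaussian {β : ℝ} (hβ : 0 < β) : Integrable (singularGaussian β) := by
  have h := integrableOn_rpow_mul_exp_neg_mul_sq (b := β / 4) (by positivity)
    (s := -(1 / 2)) (by norm_num)
  have h1 : IntegrableOn (singularGaussian β) (Set.Ioi 0) := by
    refine h.congr_fun (fun x hx => ?_) measurableSet_Ioi
    simp only [singularGaussian, abs_of_pos (Set.mem_Ioi.1 hx)]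
    congr 2; ring
  have h2 : IntegrableOn (singularGaussian β) (Set.Iio 0) := by
    have := h1.comp_neg
    simp only [Set.neg_Ioi, neg_zero] at this
    refine this.congr_fun (fun x _ => ?_) measurableSet_Iio
    exact singularGaussian_neg β x
  rw [← integrableOn_univ, ← Set.Iio_union_Ici (a := (0 : ℝ)), integrableOn_union,
    integrableOn_Ici_iff_integrableOn_Ioi]
  exact ⟨h2, h1⟩

theorem integral_singularGaussian_sq {β : ℝ} (hβ : 0 < β) :
    (∫ x, singularGaussian β x) ^ 2 = (∫ x, singularGaussian 1 x) ^ 2 / √β := by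
  have hs : 0 < √β := Real.sqrt_pos.2 hβ
  have h := Measure.integral_comp_mul_left (singularGaussian 1) (√β)
  have e : ∀ x, singularGaussian 1 (√β * x) = √β ^ (-(1 / 2) : ℝ) * singularGaussian β x := by
    intro x
    simp only [singularGaussian]
    rw [abs_mul, Real.mul_rpow (abs_nonneg _) (abs_nonneg _), abs_of_pos hs, mul_pow,
      Real.sq_sqrt hβ.le, mul_assoc]
    congr 3; ring
  simp only [e, integral_const_mul, smul_eq_mul, abs_of_pos (inv_pos.2 hs)] at h
  have h2 : (√β ^ (-(1 / 2) : ℝ)) ^ 2 = (√β)⁻¹ := by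
    rw [← Real.rpow_natCast, ← Real.rpow_mul hs.le]; norm_num
    exact Real.rpow_neg_one _
  have h3 := congrArg (· ^ 2) h
  simp only [mul_pow, h2] at h3
  field_simp at h3 ⊢
  linarith

theorem exp_linear_mul_exp_quadratic_le {σ : ℝ} (hσ : 0 < σ) (k t : ℝ) :
    Real.exp (k * t) * Real.exp (σ * (-t ^ 2 / 3)) ≤
      Real.exp (3 * k ^ 2 / σ) * Real.exp (-σ / 4 * t ^ 2) := by
  rw [← Real.exp_add, ← Real.exp_add]
  apply Real.exp_le_exp.2
  have : 3 * k ^ 2 / σ - k * t + σ * t ^ 2 / 12 = (3 / σ) * (k - σ * t / 6) ^ 2 := by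
    field_simp; ring
  have h2 : 0 ≤ (3 / σ) * (k - σ * t / 6) ^ 2 := by positivity
  linarith

theorem abs_rpow_mul_exp_le {β b s : ℝ} (hb : 0 < b) (hs : s ≠ -b) :
    |s - b| ^ (-(1 / 2) : ℝ) * Real.exp (β * (-(|s| - b) ^ 2 / 4)) ≤
      singularGaussian β (s - b) + singularGaussian β (s + b) := by
  have h1 := singularGaussian_nonneg β (s - b)
  have h2 := singularGaussian_nonneg β (s + b)
  rcases le_total 0 s with h | h
  · refine le_trans (le_of_eq ?_) (le_add_of_nonneg_right h2)
    rw [singularGaussian, abs_of_nonneg h]; congr 2; ring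
  · refine le_trans ?_ (le_add_of_nonneg_left h1)
    have : 0 < |s + b| := abs_pos.2 fun h => hs (by linarith)
    have h3 : |s + b| ≤ |s - b| := by
      rw [abs_of_nonpos (by linarith : s - b ≤ 0), abs_le]; constructor <;> linarith
    have e : Real.exp (β * (-(|s| - b) ^ 2 / 4)) = Real.exp (-β / 4 * (s + b) ^ 2) := by
      rw [abs_of_nonpos h]; congr 1; ring
    rw [e, singularGaussian]
    exact mul_le_mul_of_nonneg_right
      (Real.rpow_le_rpow_of_nonpos this h3 (by norm_num)) (Real.exp_pos _).le

section Products

variable {n : ℕ} {S b : ℝ} {ν : Fin n → ℝ}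

theorem eq_sum_sq_div (hsum : ∑ j, S / ((ν j) ^ 2 + b ^ 2 * S ^ 2) = 1) :
    S = ∑ j, S ^ 2 / ((ν j) ^ 2 + b ^ 2 * S ^ 2) := by
  calc S = S * ∑ j, S / ((ν j) ^ 2 + b ^ 2 * S ^ 2) := by rw [hsum, mul_one]
    _ = _ := by rw [Finset.mul_sum]; exact Finset.sum_congr rfl fun j _ => by ring

theorem mul_sum_eq_sum :
    S * ∑ j, S ^ 3 * b ^ 2 / ((ν j) ^ 2 + b ^ 2 * S ^ 2) ^ 2 =
      ∑ j, S ^ 4 * b ^ 2 / ((ν j) ^ 2 + b ^ 2 * S ^ 2) ^ 2 := by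
  rw [Finset.mul_sum]; exact Finset.sum_congr rfl fun j _ => by ring

theorem mul_sum_pos (hS : 0 < S) (hb : 0 < b)
    (hsum : ∑ j, S / ((ν j) ^ 2 + b ^ 2 * S ^ 2) = 1) :
    0 < S * ∑ j, S ^ 3 * b ^ 2 / ((ν j) ^ 2 + b ^ 2 * S ^ 2) ^ 2 := by
  refine mul_pos hS (Finset.sum_pos (fun j _ => by positivity) ?_)
  rw [Finset.nonempty_iff_ne_empty]
  intro h
  simp [h] at hsum

theorem vertical_prod_le (hS : 0 < S) (hb : 0 < b)
    (hsum : ∑ j, S / ((ν j) ^ 2 + b ^ 2 * S ^ 2) = 1) (s : ℝ) :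
    Real.exp (S * ((b ^ 2 - s ^ 2) / 2)) * ∏ j, √(ν j ^ 2 + S ^ 2 * s ^ 2) ≤
      (∏ j, √(ν j ^ 2 + b ^ 2 * S ^ 2)) *
        Real.exp ((S * ∑ j, S ^ 3 * b ^ 2 / ((ν j) ^ 2 + b ^ 2 * S ^ 2) ^ 2) *
          (-(|s| - b) ^ 2 / 4)) := by
  rw [mul_sum_eq_sum, Finset.sum_mul, Real.exp_sum, ← Finset.prod_mul_distrib]
  conv_lhs => rw [eq_sum_sq_div hsum, Finset.sum_mul, Real.exp_sum]
  rw [← eq_sum_sq_div hsum, ← Finset.prod_mul_distrib]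
  exact Finset.prod_le_prod (fun j _ => by positivity) fun j _ => vertical_factor_le hS hb _ _

theorem hyperbola_prod_le (hS : 0 < S) (hb : 0 < b)
    (hsum : ∑ j, S / ((ν j) ^ 2 + b ^ 2 * S ^ 2) = 1) (t : ℝ) :
    Real.exp (S * (-t ^ 2 / 3) - S * (∑ j, ν j / ((ν j) ^ 2 + b ^ 2 * S ^ 2)) * t) *
        ∏ j, √(ν j ^ 2 + b ^ 2 * S ^ 2) ≤
      Real.exp ((S * ∑ j, S ^ 3 * b ^ 2 / ((ν j) ^ 2 + b ^ 2 * S ^ 2) ^ 2) * (-t ^ 2 / 3)) *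
        ∏ j, √((S * t - ν j) ^ 2 + S ^ 2 * (b ^ 2 + t ^ 2 / 3)) := by
  have e : S * (-t ^ 2 / 3) - S * (∑ j, ν j / ((ν j) ^ 2 + b ^ 2 * S ^ 2)) * t =
      ∑ j, (S ^ 2 / (ν j ^ 2 + b ^ 2 * S ^ 2) * (-t ^ 2 / 3) +
        ν j / (ν j ^ 2 + b ^ 2 * S ^ 2) * (-S * t)) := by
    rw [Finset.sum_add_distrib, ← Finset.sum_mul, ← Finset.sum_mul, ← eq_sum_sq_div hsum]; ring
  rw [e, mul_sum_eq_sum, Finset.sum_mul, Real.exp_sum, Real.exp_sum, ← Finset.prod_mul_distrib,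
    ← Finset.prod_mul_distrib]
  exact Finset.prod_le_prod (fun j _ => by positivity) fun j _ => hyperbola_factor_le hS hb _ _

/-- Pointwise bound for the integrand between the horizontal line at height `b` and the hyperbola
`y ^ 2 = b ^ 2 + t ^ 2 / 3`, with the dependence on `z` left explicit. -/
theorem norm_kernelIntegrand_le (hS : 0 < S) (hb : 0 < b)
    (hsum : ∑ j, S / ((ν j) ^ 2 + b ^ 2 * S ^ 2) = 1) (D u v : ℝ) {t y s : ℝ}
    (hy : b ≤ y) (hy' : y ≤ √(b ^ 2 + t ^ 2 / 3)) (ht : t ≠ 0) (hs : s ≠ b) (hs' : s ≠ -b) :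
    ‖kernelIntegrand n S ν D u v ((t : ℂ) + (y : ℂ) * Complex.I) ((s : ℂ) * Complex.I)‖ ≤
      |t| ^ (-(1 / 2) : ℝ) * Real.exp (u * t) *
        (Real.exp (S * (y ^ 2 - b ^ 2 - t ^ 2) / 2 - S * D * t) *
          (∏ j, √(ν j ^ 2 + b ^ 2 * S ^ 2)) / ∏ j, √((S * t - ν j) ^ 2 + S ^ 2 * y ^ 2)) *
        (singularGaussian (S * ∑ j, S ^ 3 * b ^ 2 / ((ν j) ^ 2 + b ^ 2 * S ^ 2) ^ 2) (s - b) +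
          singularGaussian (S * ∑ j, S ^ 3 * b ^ 2 / ((ν j) ^ 2 + b ^ 2 * S ^ 2) ^ 2) (s + b)) := by
  have hy0 : 0 < y := hb.trans_le hy
  have hH : 0 < ∏ j, √((S * t - ν j) ^ 2 + S ^ 2 * y ^ 2) :=
    Finset.prod_pos fun j _ => Real.sqrt_pos.2 (by positivity)
  have ht' : 0 < |t| := abs_pos.2 ht
  have hs'' : 0 < |s - b| := abs_pos.2 (sub_ne_zero.2 hs)
  have hdist := abs_rpow_half_mul_le_norm hb hy hy' (s := s)
  have hinv : ‖(s : ℂ) * Complex.I - ((t : ℂ) + (y : ℂ) * Complex.I)‖⁻¹ ≤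
      |t| ^ (-(1 / 2) : ℝ) * |s - b| ^ (-(1 / 2) : ℝ) := by
    rw [Real.rpow_neg ht'.le, Real.rpow_neg hs''.le, ← mul_inv]
    exact inv_anti₀ (by positivity) hdist
  have hvert := vertical_prod_le hS hb hsum s
  have hgauss := abs_rpow_mul_exp_le (β := S * ∑ j, S ^ 3 * b ^ 2 /
    ((ν j) ^ 2 + b ^ 2 * S ^ 2) ^ 2) hb hs'
  rw [norm_kernelIntegrand]
  have e : Real.exp (S * (y ^ 2 - s ^ 2 - t ^ 2) / 2 - S * D * t) =
      Real.exp (S * (y ^ 2 - b ^ 2 - t ^ 2) / 2 - S * D * t) *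
        Real.exp (S * ((b ^ 2 - s ^ 2) / 2)) := by rw [← Real.exp_add]; congr 1; ring
  rw [e]
  have hE := (Real.exp_pos (S * (y ^ 2 - b ^ 2 - t ^ 2) / 2 - S * D * t)).le
  have hV : 0 ≤ Real.exp (S * ((b ^ 2 - s ^ 2) / 2)) * ∏ j, √(ν j ^ 2 + S ^ 2 * s ^ 2) := by
    positivity
  have hP : 0 ≤ ∏ j, √(ν j ^ 2 + b ^ 2 * S ^ 2) := by positivity
  have hU := (Real.exp_pos (u * t)).le
  have hT : 0 ≤ |t| ^ (-(1 / 2) : ℝ) := by positivity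
  have hB : 0 ≤ |s - b| ^ (-(1 / 2) : ℝ) := by positivity
  generalize S * ∑ j, S ^ 3 * b ^ 2 / ((ν j) ^ 2 + b ^ 2 * S ^ 2) ^ 2 = β at *
  generalize Real.exp (S * (y ^ 2 - b ^ 2 - t ^ 2) / 2 - S * D * t) = E at *
  generalize ∏ j, √((S * t - ν j) ^ 2 + S ^ 2 * y ^ 2) = H at *
  generalize ∏ j, √(ν j ^ 2 + b ^ 2 * S ^ 2) = P at *
  generalize ∏ j, √(ν j ^ 2 + S ^ 2 * s ^ 2) = V at *
  generalize |t| ^ (-(1 / 2) : ℝ) = T at *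
  generalize |s - b| ^ (-(1 / 2) : ℝ) = B at *
  generalize Real.exp (S * ((b ^ 2 - s ^ 2) / 2)) = W at *
  generalize Real.exp (u * t) = U at *
  calc U / ‖(s : ℂ) * Complex.I - ((t : ℂ) + (y : ℂ) * Complex.I)‖ * (E * W) * (V / H)
      = (U * (E / H)) * ‖(s : ℂ) * Complex.I - ((t : ℂ) + (y : ℂ) * Complex.I)‖⁻¹ * (W * V) := by
        simp only [div_eq_mul_inv]; ring
    _ ≤ (U * (E / H)) * (T * B) * (P * Real.exp (β * (-(|s| - b) ^ 2 / 4))) := by gcongr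
    _ = T * U * (E * P / H) * (B * Real.exp (β * (-(|s| - b) ^ 2 / 4))) := by ring
    _ ≤ _ := by gcongr

theorem norm_kernelIntegrand_hyperbola_le (hS : 0 < S) (hb : 0 < b)
    (hsum : ∑ j, S / ((ν j) ^ 2 + b ^ 2 * S ^ 2) = 1) (u v : ℝ) {t s : ℝ}
    (ht : t ≠ 0) (hs : s ≠ b) (hs' : s ≠ -b) :
    ‖kernelIntegrand n S ν (∑ j, ν j / ((ν j) ^ 2 + b ^ 2 * S ^ 2)) u v
        ((t : ℂ) + (√(b ^ 2 + t ^ 2 / 3) : ℝ) * Complex.I) ((s : ℂ) * Complex.I)‖ ≤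
      Real.exp (3 * u ^ 2 / (S * ∑ j, S ^ 3 * b ^ 2 / ((ν j) ^ 2 + b ^ 2 * S ^ 2) ^ 2)) *
        singularGaussian (S * ∑ j, S ^ 3 * b ^ 2 / ((ν j) ^ 2 + b ^ 2 * S ^ 2) ^ 2) t *
        (singularGaussian (S * ∑ j, S ^ 3 * b ^ 2 / ((ν j) ^ 2 + b ^ 2 * S ^ 2) ^ 2) (s - b) +
          singularGaussian (S * ∑ j, S ^ 3 * b ^ 2 / ((ν j) ^ 2 + b ^ 2 * S ^ 2) ^ 2) (s + b)) := by
  have hsq : √(b ^ 2 + t ^ 2 / 3) ^ 2 = b ^ 2 + t ^ 2 / 3 := Real.sq_sqrt (by positivity)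
  have hle : b ≤ √(b ^ 2 + t ^ 2 / 3) := Real.le_sqrt_of_sq_le (by nlinarith [sq_nonneg t])
  refine (norm_kernelIntegrand_le hS hb hsum _ u v hle le_rfl ht hs hs').trans ?_
  refine mul_le_mul_of_nonneg_right ?_
    (add_nonneg (singularGaussian_nonneg _ _) (singularGaussian_nonneg _ _))
  rw [hsq]
  have hβ := mul_sum_pos hS hb hsum
  have h1 := hyperbola_prod_le hS hb hsum t
  have h2 := exp_linear_mul_exp_quadratic_le hβ u t
  have hH : 0 < ∏ j, √((S * t - ν j) ^ 2 + S ^ 2 * (b ^ 2 + t ^ 2 / 3)) :=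
    Finset.prod_pos fun j _ => Real.sqrt_pos.2 (by positivity)
  have e : S * (b ^ 2 + t ^ 2 / 3 - b ^ 2 - t ^ 2) / 2 -
      S * (∑ j, ν j / ((ν j) ^ 2 + b ^ 2 * S ^ 2)) * t =
      S * (-t ^ 2 / 3) - S * (∑ j, ν j / ((ν j) ^ 2 + b ^ 2 * S ^ 2)) * t := by ring
  rw [e, mul_assoc]
  rw [← div_le_iff₀ hH] at h1
  calc _ ≤ |t| ^ (-(1 / 2) : ℝ) * (Real.exp (u * t) * _) := by gcongr
    _ ≤ _ := mul_le_mul_of_nonneg_left h2 (by positivity)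
    _ = _ := by rw [singularGaussian]; ring

theorem exists_norm_kernelIntegrand_le (hS : 0 < S) (hb : 0 < b)
    (hsum : ∑ j, S / ((ν j) ^ 2 + b ^ 2 * S ^ 2) = 1) (D u v : ℝ) :
    ∃ K, ∀ t y s : ℝ, b ≤ y → y ≤ √(b ^ 2 + t ^ 2 / 3) → t ≠ 0 → s ≠ b → s ≠ -b →
    ‖kernelIntegrand n S ν D u v ((t : ℂ) + (y : ℂ) * Complex.I) ((s : ℂ) * Complex.I)‖ ≤
      K * singularGaussian S t *
        (singularGaussian (S * ∑ j, S ^ 3 * b ^ 2 / ((ν j) ^ 2 + b ^ 2 * S ^ 2) ^ 2) (s - b) +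
          singularGaussian (S * ∑ j, S ^ 3 * b ^ 2 / ((ν j) ^ 2 + b ^ 2 * S ^ 2) ^ 2) (s + b)) := by
  refine ⟨Real.exp (3 * (u - S * D) ^ 2 / S) * ((∏ j, √(ν j ^ 2 + b ^ 2 * S ^ 2)) /
    ∏ _j : Fin n, (S * b)), fun t y s hy hy' ht hs hs' => ?_⟩
  refine (norm_kernelIntegrand_le hS hb hsum D u v hy hy' ht hs hs').trans ?_
  refine mul_le_mul_of_nonneg_right ?_
    (add_nonneg (singularGaussian_nonneg _ _) (singularGaussian_nonneg _ _))
  have hH : ∏ _j : Fin n, (S * b) ≤ ∏ j, √((S * t - ν j) ^ 2 + S ^ 2 * y ^ 2) := by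
    refine Finset.prod_le_prod (fun j _ => by positivity) fun j _ => Real.le_sqrt_of_sq_le ?_
    rw [mul_pow]
    have : S ^ 2 * b ^ 2 ≤ S ^ 2 * y ^ 2 := by gcongr
    nlinarith [sq_nonneg (S * t - ν j)]
  have hH0 : 0 < ∏ _j : Fin n, (S * b) := Finset.prod_pos fun _ _ => by positivity
  have h2 : y ^ 2 ≤ b ^ 2 + t ^ 2 / 3 := by
    have := Real.sq_sqrt (by positivity : 0 ≤ b ^ 2 + t ^ 2 / 3)
    nlinarith
  have h3 : Real.exp (S * (y ^ 2 - b ^ 2 - t ^ 2) / 2 - S * D * t) ≤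
      Real.exp (S * (-t ^ 2 / 3) - S * D * t) := by
    apply Real.exp_le_exp.2
    nlinarith
  have h4 := exp_linear_mul_exp_quadratic_le hS (u - S * D) t
  calc _ ≤ |t| ^ (-(1 / 2) : ℝ) * Real.exp (u * t) * (Real.exp (S * (-t ^ 2 / 3) - S * D * t) *
          (∏ j, √(ν j ^ 2 + b ^ 2 * S ^ 2)) / ∏ _j : Fin n, (S * b)) := by gcongr
    _ = |t| ^ (-(1 / 2) : ℝ) * ((∏ j, √(ν j ^ 2 + b ^ 2 * S ^ 2)) / ∏ _j : Fin n, (S * b)) *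
        (Real.exp ((u - S * D) * t) * Real.exp (S * (-t ^ 2 / 3))) := by
      have : Real.exp (u * t) * Real.exp (S * (-t ^ 2 / 3) - S * D * t) =
          Real.exp ((u - S * D) * t) * Real.exp (S * (-t ^ 2 / 3)) := by
        rw [← Real.exp_add, ← Real.exp_add]; congr 1; ring
      rw [← this]; ring
    _ ≤ _ := mul_le_mul_of_nonneg_left h4 (by positivity)
    _ = _ := by rw [singularGaussian]; ring

end Products

section Contour

theorem hasDerivAt_sqrt_add_sq_div {b : ℝ} (hb : 0 < b) (t : ℝ) :
    HasDerivAt (fun t : ℝ => √(b ^ 2 + t ^ 2 / 3)) (t / (3 * √(b ^ 2 + t ^ 2 / 3))) t := by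
  have h2 : HasDerivAt (fun x : ℝ => x ^ 2) (2 * t) t := by simpa using hasDerivAt_pow 2 t
  refine HasDerivAt.congr_deriv (((h2.div_const 3).const_add (b ^ 2)).sqrt (by positivity)) ?_
  have : √(b ^ 2 + t ^ 2 / 3) ≠ 0 := (Real.sqrt_pos.2 (by positivity)).ne'
  field_simp

theorem norm_hyperbola_velocity_le {b : ℝ} (hb : 0 < b) {ε : ℝ} (hε : |ε| = 1) (t : ℝ) :
    ‖(ε : ℂ) + ((t / (3 * √(b ^ 2 + t ^ 2 / 3)) : ℝ) : ℂ) * Complex.I‖ ≤ 2 := by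
  have h0 : 0 < √(b ^ 2 + t ^ 2 / 3) := Real.sqrt_pos.2 (by positivity)
  have h1 : |t / (3 * √(b ^ 2 + t ^ 2 / 3))| ≤ 1 := by
    rw [abs_div, abs_of_pos (by positivity : 0 < 3 * √(b ^ 2 + t ^ 2 / 3)),
      div_le_one (by positivity)]
    refine abs_le_of_sq_le_sq ?_ (by positivity)
    rw [mul_pow, Real.sq_sqrt (by positivity)]
    nlinarith [sq_nonneg t, sq_nonneg b]
  refine (norm_add_le _ _).trans ?_
  rw [norm_mul, Complex.norm_I, mul_one, Complex.norm_real, Complex.norm_real, Real.norm_eq_abs,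
    Real.norm_eq_abs, hε]
  linarith

theorem sqrt_add_sq_div_sub_le {b t : ℝ} (hb : 0 < b) (ht : 0 ≤ t) :
    √(b ^ 2 + t ^ 2 / 3) - b ≤ t := by
  rw [sub_le_iff_le_add]
  exact Real.sqrt_le_iff.2 ⟨by positivity, by nlinarith⟩

theorem mul_singularGaussian {σ t : ℝ} (ht : 0 ≤ t) :
    t * singularGaussian σ t = t ^ (1 / 2 : ℝ) * Real.exp (-σ / 4 * t ^ 2) := by
  rcases ht.eq_or_lt with rfl | ht
  · simp
  · rw [singularGaussian, abs_of_pos ht, ← mul_assoc]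
    congr 1
    nth_rewrite 1 [← Real.rpow_one t]
    rw [← Real.rpow_add ht]; norm_num

theorem tendsto_rpow_mul_exp_sq_atTop {σ : ℝ} (hσ : 0 < σ) :
    Filter.Tendsto (fun t : ℝ => t ^ (1 / 2 : ℝ) * Real.exp (-σ / 4 * t ^ 2)) Filter.atTop
      (nhds 0) := by
  refine squeeze_zero' (Filter.eventually_atTop.2 ⟨0, fun t ht => by positivity⟩)
    (Filter.eventually_atTop.2 ⟨1, fun t ht => ?_⟩)
    (tendsto_rpow_mul_exp_neg_mul_atTop_nhds_zero (1 / 2) (σ / 4) (by positivity))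
  have : t ≤ t ^ 2 := by nlinarith
  have h0 : 0 ≤ t := by linarith
  exact mul_le_mul_of_nonneg_left (Real.exp_le_exp.2 (by nlinarith)) (by positivity)

variable {f : ℂ → ℂ} {b σ K : ℝ}

theorem integrable_of_norm_le_singularGaussian (hσ : 0 < σ) {g : ℝ → ℂ} (hg : Measurable g)
    (h : ∀ t, t ≠ 0 → ‖g t‖ ≤ K * singularGaussian σ t) : Integrable g := by
  refine ((integrable_singularGaussian hσ).const_mul K).mono' hg.aestronglyMeasurable ?_
  filter_upwards [Measure.ae_ne volume (0 : ℝ)] with t ht using h t ht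

theorem integral_Ioi_hyperbola_eq (hb : 0 < b) (hσ : 0 < σ) (hfm : Measurable f)
    (hf : ∀ z : ℂ, z.re ≠ 0 → 0 < z.im → DifferentiableAt ℂ f z)
    (hbound : ∀ t y : ℝ, t ≠ 0 → b ≤ y → y ≤ √(b ^ 2 + t ^ 2 / 3) →
      ‖f ((t : ℂ) + (y : ℂ) * Complex.I)‖ ≤ K * singularGaussian σ t)
    {ε : ℝ} (hε : |ε| = 1) :
    ∫ t in Set.Ioi (0 : ℝ), f (((ε * t : ℝ) : ℂ) + (√(b ^ 2 + t ^ 2 / 3) : ℝ) * Complex.I) *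
        ((ε : ℂ) + ((t / (3 * √(b ^ 2 + t ^ 2 / 3)) : ℝ) : ℂ) * Complex.I) =
      ∫ t in Set.Ioi (0 : ℝ), f (((ε * t : ℝ) : ℂ) + (b : ℂ) * Complex.I) * (ε : ℂ) := by
  have hε2 : ε ^ 2 = 1 := by rw [← sq_abs, hε, one_pow]
  have hε0 : ε ≠ 0 := by rintro rfl; simp at hε
  have hsq : ∀ t : ℝ, (ε * t) ^ 2 = t ^ 2 := fun t => by rw [mul_pow, hε2, one_mul]
  have hG : ∀ t : ℝ, singularGaussian σ (ε * t) = singularGaussian σ t := fun t => by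
    rw [singularGaussian, singularGaussian, hsq, abs_mul, hε, one_mul]
  have hbd : ∀ t y : ℝ, t ≠ 0 → b ≤ y → y ≤ √(b ^ 2 + t ^ 2 / 3) →
      ‖f (((ε * t : ℝ) : ℂ) + (y : ℂ) * Complex.I)‖ ≤ K * singularGaussian σ t := by
    intro t y ht hy hy'
    rw [← hG]
    exact hbound _ _ (mul_ne_zero hε0 ht) hy (by rwa [hsq])
  have hle : ∀ t : ℝ, b ≤ √(b ^ 2 + t ^ 2 / 3) := fun t =>
    Real.le_sqrt_of_sq_le (by nlinarith [sq_nonneg t])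
  let U : Set ℂ := {z | 0 < ε * z.re} ∩ {z | 0 < z.im}
  have hUo : IsOpen U := (isOpen_lt continuous_const (by fun_prop)).inter
    (isOpen_lt continuous_const Complex.continuous_im)
  have hUc : Convex ℝ U := by
    intro z hz w hw p q hp hq hpq
    simp only [U, Set.mem_inter_iff, Set.mem_ofPred_eq] at hz hw ⊢
    have key : ∀ x y : ℝ, 0 < x → 0 < y → 0 < p * x + q * y := fun x y hx hy => by
      rcases hp.eq_or_lt with rfl | hp
      · have : q = 1 := by linarith
        simpa [this] using hy
      · positivity
    simp only [Complex.add_re, Complex.add_im, Complex.smul_re, Complex.smul_im, smul_eq_mul]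
    refine ⟨?_, key _ _ hz.2 hw.2⟩
    have := key _ _ hz.1 hw.1
    linarith
  obtain ⟨P, hP⟩ := hUc.exists_forall_hasDerivWithinAt (f := f) fun z hz =>
    (hf z (fun h => by simp [U, h] at hz) hz.2).differentiableWithinAt
  have hP' : ∀ z ∈ U, HasDerivAt P (f z) z := fun z hz => (hP z hz).hasDerivAt (hUo.mem_nhds hz)
  have hmem : ∀ t y : ℝ, 0 < t → 0 < y → ((ε * t : ℝ) : ℂ) + (y : ℂ) * Complex.I ∈ U := by
    intro t y ht hy
    simp only [U, Set.mem_inter_iff, Set.mem_ofPred_eq]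
    constructor
    · have : ε * (ε * t) = t := by rw [← mul_assoc, ← sq, hε2, one_mul]
      simpa [this] using ht
    · simpa using hy
  let V : ℝ → ℂ := fun t => P (((ε * t : ℝ) : ℂ) + (√(b ^ 2 + t ^ 2 / 3) : ℝ) * Complex.I) -
    P (((ε * t : ℝ) : ℂ) + (b : ℂ) * Complex.I)
  have hV0 : V 0 = 0 := by simp [V, Real.sqrt_sq hb.le]
  have hVle : ∀ t : ℝ, 0 ≤ t → ‖V t‖ ≤ K * (t ^ (1 / 2 : ℝ) * Real.exp (-σ / 4 * t ^ 2)) := by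
    intro t ht
    rcases ht.eq_or_lt with rfl | ht
    · simp [hV0]
    have hconv : Convex ℝ (({ε * t} : Set ℝ) ×ℂ Set.Icc b (√(b ^ 2 + t ^ 2 / 3))) :=
      ((convex_singleton _).linear_preimage Complex.reLm).inter
        ((convex_Icc _ _).linear_preimage Complex.imLm)
    have hform : ∀ z ∈ (({ε * t} : Set ℝ) ×ℂ Set.Icc b (√(b ^ 2 + t ^ 2 / 3))),
        z = ((ε * t : ℝ) : ℂ) + (z.im : ℂ) * Complex.I := by
      intro z hz
      rw [← (show z.re = ε * t from hz.1), Complex.re_add_im]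
    have hmv := hconv.norm_image_sub_le_of_norm_hasDerivWithin_le (f := P) (f' := f)
      (C := K * singularGaussian σ t)
      (x := ((ε * t : ℝ) : ℂ) + (b : ℂ) * Complex.I)
      (y := ((ε * t : ℝ) : ℂ) + (√(b ^ 2 + t ^ 2 / 3) : ℝ) * Complex.I)
      (fun z hz => by
        refine (hP' z ?_).hasDerivWithinAt
        rw [hform z hz]
        exact hmem _ _ ht (hb.trans_le hz.2.1))
      (fun z hz => by
        rw [hform z hz]
        exact hbd _ _ ht.ne' hz.2.1 hz.2.2)
      (by simpa [Complex.mem_reProdIm] using hle t) (by simpa [Complex.mem_reProdIm] using hle t)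
    have hKG : 0 ≤ K * singularGaussian σ t := (norm_nonneg _).trans (hbd t b ht.ne' le_rfl (hle t))
    have hn : ‖((ε * t : ℝ) : ℂ) + (√(b ^ 2 + t ^ 2 / 3) : ℝ) * Complex.I -
        (((ε * t : ℝ) : ℂ) + (b : ℂ) * Complex.I)‖ ≤ t := by
      have e : ((ε * t : ℝ) : ℂ) + (√(b ^ 2 + t ^ 2 / 3) : ℝ) * Complex.I -
        (((ε * t : ℝ) : ℂ) + (b : ℂ) * Complex.I) =
          ((√(b ^ 2 + t ^ 2 / 3) - b : ℝ) : ℂ) * Complex.I := by push_cast; ring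
      rw [e, norm_mul, Complex.norm_I, mul_one, Complex.norm_real, Real.norm_eq_abs,
        abs_of_nonneg (sub_nonneg.2 (hle t))]
      exact sqrt_add_sq_div_sub_le hb ht.le
    rw [← mul_singularGaussian ht.le]
    refine hmv.trans ((mul_le_mul_of_nonneg_left hn hKG).trans (le_of_eq (by ring)))
  have hderiv : ∀ t ∈ Set.Ioi (0 : ℝ), HasDerivAt V
      (f (((ε * t : ℝ) : ℂ) + (√(b ^ 2 + t ^ 2 / 3) : ℝ) * Complex.I) *
        ((ε : ℂ) + ((t / (3 * √(b ^ 2 + t ^ 2 / 3)) : ℝ) : ℂ) * Complex.I) -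
      f (((ε * t : ℝ) : ℂ) + (b : ℂ) * Complex.I) * (ε : ℂ)) t := by
    intro t ht
    have h1 : HasDerivAt (fun t : ℝ => ((ε * t : ℝ) : ℂ)) (ε : ℂ) t := by
      simpa using ((hasDerivAt_id t).const_mul ε).ofReal_comp
    have h2 := ((hasDerivAt_sqrt_add_sq_div hb t).ofReal_comp).mul_const Complex.I
    have h3 := (hP' _ (hmem t _ ht (hb.trans_le (hle t)))).scomp t (h1.add h2)
    have h4 := (hP' _ (hmem t _ ht hb)).scomp t (h1.add_const ((b : ℂ) * Complex.I))
    refine (h3.sub h4).congr_deriv ?_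
    simp only [smul_eq_mul]; ring
  have hint1 : Integrable fun t : ℝ =>
      f (((ε * t : ℝ) : ℂ) + (√(b ^ 2 + t ^ 2 / 3) : ℝ) * Complex.I) *
        ((ε : ℂ) + ((t / (3 * √(b ^ 2 + t ^ 2 / 3)) : ℝ) : ℂ) * Complex.I) := by
    refine integrable_of_norm_le_singularGaussian (K := K * 2) hσ (by fun_prop) fun t ht => ?_
    rw [norm_mul]
    calc _ ≤ (K * singularGaussian σ t) * 2 := mul_le_mul (hbd t _ ht (hle t) le_rfl)
          (norm_hyperbola_velocity_le hb hε t) (norm_nonneg _)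
          ((norm_nonneg _).trans (hbd t _ ht (hle t) le_rfl))
      _ = _ := by ring
  have hint2 : Integrable fun t : ℝ =>
      f (((ε * t : ℝ) : ℂ) + (b : ℂ) * Complex.I) * (ε : ℂ) := by
    refine integrable_of_norm_le_singularGaussian (K := K) hσ (by fun_prop) fun t ht => ?_
    rw [norm_mul, Complex.norm_real, Real.norm_eq_abs, hε, mul_one]
    exact hbd t _ ht le_rfl (hle t)
  have hcont : ContinuousWithinAt V (Set.Ici 0) 0 := by
    rw [ContinuousWithinAt, hV0]
    have hc : Continuous fun t : ℝ => K * (t ^ (1 / 2 : ℝ) * Real.exp (-σ / 4 * t ^ 2)) := by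
      have : Continuous fun t : ℝ => t ^ (1 / 2 : ℝ) :=
        Real.continuous_rpow_const (by norm_num)
      fun_prop
    have h0 := hc.continuousWithinAt (s := Set.Ici 0) (x := 0)
    rw [ContinuousWithinAt] at h0
    norm_num at h0
    refine squeeze_zero_norm' ?_ h0
    filter_upwards [self_mem_nhdsWithin] with t ht
    have := hVle t ht
    norm_num at this
    exact this
  have hlim : Filter.Tendsto V Filter.atTop (nhds 0) := by
    refine squeeze_zero_norm' (Filter.eventually_atTop.2 ⟨0, hVle⟩) ?_
    simpa using (tendsto_rpow_mul_exp_sq_atTop hσ).const_mul K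
  have h := integral_Ioi_of_hasDerivAt_of_tendsto hcont hderiv
    (hint1.sub hint2).integrableOn hlim
  rw [hV0, sub_zero, integral_sub hint1.integrableOn hint2.integrableOn] at h
  exact sub_eq_zero.1 h

/-- Deformation of the horizontal line at height `b` to the hyperbola `y ^ 2 = b ^ 2 + t ^ 2 / 3`,
for functions that may be singular on the imaginary axis. -/
theorem integral_line_eq_integral_hyperbola (hb : 0 < b) (hσ : 0 < σ) (hfm : Measurable f)
    (hf : ∀ z : ℂ, z.re ≠ 0 → 0 < z.im → DifferentiableAt ℂ f z)
    (hbound : ∀ t y : ℝ, t ≠ 0 → b ≤ y → y ≤ √(b ^ 2 + t ^ 2 / 3) →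
      ‖f ((t : ℂ) + (y : ℂ) * Complex.I)‖ ≤ K * singularGaussian σ t) :
    ∫ t : ℝ, f ((t : ℂ) + (b : ℂ) * Complex.I) =
      ∫ t : ℝ, f ((t : ℂ) + (√(b ^ 2 + t ^ 2 / 3) : ℝ) * Complex.I) *
        (((1 : ℝ) : ℂ) + ((t / (3 * √(b ^ 2 + t ^ 2 / 3)) : ℝ) : ℂ) * Complex.I) := by
  have hle : ∀ t : ℝ, b ≤ √(b ^ 2 + t ^ 2 / 3) := fun t =>
    Real.le_sqrt_of_sq_le (by nlinarith [sq_nonneg t])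
  have hint1 : Integrable fun t : ℝ => f ((t : ℂ) + (√(b ^ 2 + t ^ 2 / 3) : ℝ) * Complex.I) *
        (((1 : ℝ) : ℂ) + ((t / (3 * √(b ^ 2 + t ^ 2 / 3)) : ℝ) : ℂ) * Complex.I) := by
    refine integrable_of_norm_le_singularGaussian (K := K * 2) hσ (by fun_prop) fun t ht => ?_
    rw [norm_mul]
    calc _ ≤ (K * singularGaussian σ t) * 2 := mul_le_mul (hbound t _ ht (hle t) le_rfl)
          (norm_hyperbola_velocity_le hb (by simp) t) (norm_nonneg _)
          ((norm_nonneg _).trans (hbound t _ ht (hle t) le_rfl))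
      _ = _ := by ring
  have hint2 : Integrable fun t : ℝ => f ((t : ℂ) + (b : ℂ) * Complex.I) :=
    integrable_of_norm_le_singularGaussian (K := K) hσ (by fun_prop) fun t ht =>
      hbound t _ ht le_rfl (hle t)
  have hpos := integral_Ioi_hyperbola_eq hb hσ hfm hf hbound (ε := 1) (by simp)
  have hneg := integral_Ioi_hyperbola_eq hb hσ hfm hf hbound (ε := -1) (by simp)
  rw [← intervalIntegral.integral_Iic_add_Ioi (b := 0) hint1.integrableOn hint1.integrableOn,
    ← intervalIntegral.integral_Iic_add_Ioi (b := 0) hint2.integrableOn hint2.integrableOn]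
  congr 1
  · rw [← neg_zero, ← integral_comp_neg_Ioi, ← integral_comp_neg_Ioi]
    rw [← neg_inj, ← integral_neg, ← integral_neg]
    refine Eq.trans ?_ (hneg.symm.trans ?_)
    · refine setIntegral_congr_fun measurableSet_Ioi fun t _ => ?_
      simp
    · refine setIntegral_congr_fun measurableSet_Ioi fun t _ => ?_
      simp only [neg_sq, neg_mul, one_mul]
      push_cast
      ring
  · refine Eq.trans ?_ (hpos.symm.trans ?_) <;>
    · refine setIntegral_congr_fun measurableSet_Ioi fun t _ => ?_
      simp

end Contour

section Fubini

variable {n : ℕ} {S b : ℝ} {ν : Fin n → ℝ} {D u v : ℝ}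

theorem measurable_kernelIntegrand :
    Measurable fun p : ℂ × ℂ => kernelIntegrand n S ν D u v p.1 p.2 := by
  unfold kernelIntegrand
  fun_prop

theorem differentiableAt_kernelIntegrand (hS : 0 < S) {z w : ℂ} (hzw : w - z ≠ 0)
    (hz : 0 < z.im) : DifferentiableAt ℂ (fun z => kernelIntegrand n S ν D u v z w) z := by
  have h : ∀ j, (S : ℂ) * z - (ν j : ℂ) ≠ 0 := fun j hj => by
    have := congrArg Complex.im hj
    simp [hS.ne', hz.ne'] at this
  unfold kernelIntegrand
  fun_prop (disch := first | exact hzw | exact h _)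

/-- The contribution of one horizontal line to the double integral. -/
theorem norm_integral_integral_kernelIntegrand_le (hS : 0 < S) (hb : 0 < b)
    (hsum : ∑ j, S / ((ν j) ^ 2 + b ^ 2 * S ^ 2) = 1) (u v : ℝ) :
    ‖∫ t : ℝ, ∫ s : ℝ, kernelIntegrand n S ν (∑ j, ν j / ((ν j) ^ 2 + b ^ 2 * S ^ 2)) u v
        ((t : ℂ) + (b : ℂ) * Complex.I) ((s : ℂ) * Complex.I)‖ ≤
      4 * (∫ x, singularGaussian 1 x) ^ 2 /
          √(S * ∑ j, S ^ 3 * b ^ 2 / ((ν j) ^ 2 + b ^ 2 * S ^ 2) ^ 2) *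
        Real.exp (3 * u ^ 2 /
          (S * ∑ j, S ^ 3 * b ^ 2 / ((ν j) ^ 2 + b ^ 2 * S ^ 2) ^ 2)) := by
  obtain ⟨K, hK⟩ := exists_norm_kernelIntegrand_le hS hb hsum
    (∑ j, ν j / ((ν j) ^ 2 + b ^ 2 * S ^ 2)) u v
  have hyp := fun t s => norm_kernelIntegrand_hyperbola_le hS hb hsum u v (t := t) (s := s)
  have hβ := mul_sum_pos hS hb hsum
  generalize S * ∑ j, S ^ 3 * b ^ 2 / ((ν j) ^ 2 + b ^ 2 * S ^ 2) ^ 2 = β at *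
  generalize ∑ j, ν j / ((ν j) ^ 2 + b ^ 2 * S ^ 2) = D at *
  have hle : ∀ t : ℝ, b ≤ √(b ^ 2 + t ^ 2 / 3) := fun t =>
    Real.le_sqrt_of_sq_le (by nlinarith [sq_nonneg t])
  have hG := integrable_singularGaussian hβ
  have hg : Integrable fun s => singularGaussian β (s - b) + singularGaussian β (s + b) :=
    (hG.comp_sub_right b).add (hG.comp_add_right b)
  have hgi : ∫ s, (singularGaussian β (s - b) + singularGaussian β (s + b)) =
      2 * ∫ x, singularGaussian β x := by
    rw [integral_add (hG.comp_sub_right b) (hG.comp_add_right b),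
      integral_sub_right_eq_self (singularGaussian β), integral_add_right_eq_self]
    ring
  have hint : Integrable (Function.uncurry fun t s : ℝ => kernelIntegrand n S ν D u v
      ((t : ℂ) + (b : ℂ) * Complex.I) ((s : ℂ) * Complex.I)) (volume.prod volume) := by
    refine Integrable.mono'
      (((integrable_singularGaussian hS).const_mul K).mul_prod hg) ?_ ?_
    · exact (measurable_kernelIntegrand.comp (by fun_prop : Measurable fun p : ℝ × ℝ =>
        (((p.1 : ℂ) + (b : ℂ) * Complex.I), ((p.2 : ℂ) * Complex.I)))).aestronglyMeasurable
    · filter_upwards [Measure.quasiMeasurePreserving_fst.ae (Measure.ae_ne volume (0 : ℝ)),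
        Measure.quasiMeasurePreserving_snd.ae (Measure.ae_ne volume b),
        Measure.quasiMeasurePreserving_snd.ae (Measure.ae_ne volume (-b))] with p ht hs hs'
      exact hK _ _ _ le_rfl (hle _) ht hs hs'
  rw [integral_integral_swap hint]
  have hbd : ∀ᵐ s : ℝ, ‖∫ t : ℝ, kernelIntegrand n S ν D u v
      ((t : ℂ) + (b : ℂ) * Complex.I) ((s : ℂ) * Complex.I)‖ ≤
      2 * Real.exp (3 * u ^ 2 / β) * (∫ x, singularGaussian β x) *
        (singularGaussian β (s - b) + singularGaussian β (s + b)) := by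
    filter_upwards [Measure.ae_ne volume b, Measure.ae_ne volume (-b)] with s hs hs'
    have hmeas : Measurable fun z => kernelIntegrand n S ν D u v z ((s : ℂ) * Complex.I) := by
      unfold kernelIntegrand
      fun_prop
    have hdiff : ∀ z : ℂ, z.re ≠ 0 → 0 < z.im → DifferentiableAt ℂ
        (fun z => kernelIntegrand n S ν D u v z ((s : ℂ) * Complex.I)) z := fun z hz hz' =>
      differentiableAt_kernelIntegrand hS (fun h => hz (by simpa using congrArg Complex.re h)) hz'
    have hshift := integral_line_eq_integral_hyperbola hb hS hmeas hdiff (K := K *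
      (singularGaussian β (s - b) + singularGaussian β (s + b)))
      (fun t y ht hy hy' => (hK t y s hy hy' ht hs hs').trans (le_of_eq (by ring)))
    rw [hshift]
    refine (norm_integral_le_of_norm_le (hG.const_mul (2 * Real.exp (3 * u ^ 2 / β) *
      (singularGaussian β (s - b) + singularGaussian β (s + b)))) ?_).trans (le_of_eq ?_)
    · filter_upwards [Measure.ae_ne volume (0 : ℝ)] with t ht
      rw [norm_mul]
      have h := hyp t s ht hs hs'
      refine (mul_le_mul h (norm_hyperbola_velocity_le hb (by simp) t) (norm_nonneg _)
        ((norm_nonneg _).trans h)).trans (le_of_eq (by ring))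
    · rw [integral_const_mul]; ring
  refine (norm_integral_le_of_norm_le (hg.const_mul _) hbd).trans (le_of_eq ?_)
  rw [integral_const_mul, hgi, mul_div_assoc 4, ← integral_singularGaussian_sq hβ]
  ring

end Fubini

theorem norm_inv_two_pi_I_sq_le : ‖((2 * (π : ℂ) * Complex.I) ^ 2)⁻¹‖ ≤ 1 := by
  rw [norm_inv, norm_pow, norm_mul, norm_mul, Complex.norm_I, Complex.norm_real,
    Real.norm_of_nonneg Real.pi_pos.le, Complex.norm_ofNat, mul_one]
  exact inv_le_one_of_one_le₀ (one_le_pow₀ (by linarith [Real.pi_gt_three]))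

/-- There is a numerical constant `C` such that for every `n ≥ 1`,
`S > 0` and `ν ∈ B_{n,S}` (i.e. `b = b(ν) > 0` satisfies `∑ⱼ S/(νⱼ² + b²S²) = 1`),
and all `u, v ∈ ℝ`: `|K̃_{n,S}^ν(u,v)| ≤ C·(S·A(ν))^{−1/2}·exp(3u²/(S·A(ν)))`,
where `A(ν) = ∑ⱼ S³b²/(νⱼ² + b²S²)²`. -/
theorem statement1 :
    ∃ C : ℝ, ∀ (n : ℕ), 1 ≤ n → ∀ S : ℝ, 0 < S → ∀ (ν : Fin n → ℝ) (b : ℝ), 0 < b →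
      (∑ j, S / ((ν j) ^ 2 + b ^ 2 * S ^ 2)) = 1 →
      ∀ u v : ℝ,
      ‖Ktilde n S ν b u v‖ ≤
        C / Real.sqrt (S * ∑ j, S ^ 3 * b ^ 2 / ((ν j) ^ 2 + b ^ 2 * S ^ 2) ^ 2) *
          Real.exp (3 * u ^ 2 /
            (S * ∑ j, S ^ 3 * b ^ 2 / ((ν j) ^ 2 + b ^ 2 * S ^ 2) ^ 2)) := by
  refine ⟨8 * (∫ x, singularGaussian 1 x) ^ 2, fun n _ S hS ν b hb hsum u v => ?_⟩
  have hJ := norm_integral_integral_kernelIntegrand_le hS hb hsum u v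
  set D : ℝ := ∑ j, ν j / ((ν j) ^ 2 + b ^ 2 * S ^ 2)
  set β : ℝ := S * ∑ j, S ^ 3 * b ^ 2 / ((ν j) ^ 2 + b ^ 2 * S ^ 2) ^ 2
  set J : ℂ := ∫ t : ℝ, ∫ s : ℝ, kernelIntegrand n S ν D u v
    ((t : ℂ) + (b : ℂ) * Complex.I) ((s : ℂ) * Complex.I) with hJdef
  have hupper : ∫ t : ℝ, (∫ s : ℝ, kernelIntegrand n S ν D u v
      (-(t : ℂ) + (b : ℂ) * Complex.I) ((s : ℂ) * Complex.I) * Complex.I) * (-1) =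
      J * Complex.I * (-1) := by
    simp only [integral_mul_const]
    congr 2
    rw [hJdef, ← integral_neg_eq_self]
    simp
  have hlower : ∫ t : ℝ, ∫ s : ℝ, kernelIntegrand n S ν D u v
      ((t : ℂ) - (b : ℂ) * Complex.I) ((s : ℂ) * Complex.I) * Complex.I =
      starRingEnd ℂ J * Complex.I := by
    simp only [integral_mul_const]
    congr 1
    rw [hJdef, ← integral_conj]
    congr 1
    ext t
    rw [← integral_conj, ← integral_neg_eq_self]
    congr 1
    ext s
    rw [← kernelIntegrand_conj]
    simp [sub_eq_add_neg]
  have hK : Ktilde n S ν b u v = ((2 * (π : ℂ) * Complex.I) ^ 2)⁻¹ *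
      (J * Complex.I * (-1) + starRingEnd ℂ J * Complex.I) := by
    rw [← hupper, ← hlower]; rfl
  rw [hK, norm_mul]
  calc _ ≤ 1 * (‖J‖ + ‖J‖) := by
        gcongr
        · exact norm_inv_two_pi_I_sq_le
        · refine (norm_add_le _ _).trans (le_of_eq ?_)
          simp
    _ ≤ _ := by
        rw [one_mul]
        refine (add_le_add hJ hJ).trans (le_of_eq ?_)
        ring
end

section
/- There are constants C > 0 and S₀ > 0, depending only on α₀ and β₀, with the following property: for every n ≥ 1, every S ≥ S₀, every ν and b satisfying the edge conditions below, and every ξ ≥ 0, setting u = ξ·d·S^{1/3}, one has d·S^{1/3}·|I(ξ)| ≤ C·e^{−ξ}, where I(ξ) = (1/(2πi)²) ∫_{γ} dz ∫_{Γ} dw e^{u(z − w)} (w − z)^{-1} e^{S(w² − z²)/2 − aS(w − z)} Π_{j=1}^n (Sw − ν_j)/(Sz − ν_j), with γ the contour parametrized by z(t) = b + t·e^{iπ/6} for t ≤ 0 and z(t) = b + t·e^{5iπ/6} for t ≥ 0 (t ∈ ℝ increasing), and Γ the upward-oriented vertical line w(s) = b + is (s ∈ ℝ); the double integral converges absolutely.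 -/
open scoped Real BigOperators
open MeasureTheory

/-- The rescaled diagonal edge quantity
`I(ξ) = (1/(2πi)²) ∫_γ dz ∫_Γ dw e^{u(z−w)}(w−z)⁻¹ e^{S(w²−z²)/2 − aS(w−z)}
· Πⱼ (Sw−νⱼ)/(Sz−νⱼ)`, written as an iterated integral over the parametrized
contours `γ : z(t) = b + t·e^{iπ/6}` for `t ≤ 0`, `z(t) = b + t·e^{5iπ/6}` for
`t ≥ 0` (with the corresponding derivative factor), and the upward vertical line
`Γ : w(s) = b + is`. -/
noncomputable def edgeI (n : ℕ) (S : ℝ) (ν : Fin n → ℝ) (b a u : ℝ) : ℂ :=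
  let F : ℂ → ℂ → ℂ := fun z w =>
    Complex.exp ((u : ℂ) * (z - w)) / (w - z) *
      Complex.exp ((S : ℂ) * (w ^ 2 - z ^ 2) / 2 - (a : ℂ) * (S : ℂ) * (w - z)) *
      ∏ j, ((S : ℂ) * w - (ν j : ℂ)) / ((S : ℂ) * z - (ν j : ℂ))
  let zc : ℝ → ℂ := fun t =>
    if t ≤ 0 then (b : ℂ) + (t : ℂ) * Complex.exp (Complex.I * π / 6)
    else (b : ℂ) + (t : ℂ) * Complex.exp (5 * Complex.I * π / 6)
  let zd : ℝ → ℂ := fun t =>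
    if t ≤ 0 then Complex.exp (Complex.I * π / 6)
    else Complex.exp (5 * Complex.I * π / 6)
  (1 / (2 * (π : ℂ) * Complex.I)) ^ 2 *
    ∫ t : ℝ, (∫ s : ℝ, F (zc t) ((b : ℂ) + (s : ℂ) * Complex.I) * Complex.I) * zd t

open Filter Topology Set

/-- Cauchy's theorem on a horizontal strip: a holomorphic function dominated by a function of the
real part that vanishes at `±∞` has the same integral over the two boundary lines. -/
lemma integral_horizontal_line_eq {g : ℂ → ℂ} {y₁ y₂ : ℝ} {B : ℝ → ℝ}
    (hg : ∀ z : ℂ, z.im ∈ uIcc y₁ y₂ → DifferentiableAt ℂ g z)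
    (hB : ∀ z : ℂ, z.im ∈ uIcc y₁ y₂ → ‖g z‖ ≤ B z.re)
    (hBi : Integrable B) (htop : Tendsto B atTop (𝓝 0)) (hbot : Tendsto B atBot (𝓝 0)) :
    ∫ x : ℝ, g (x + y₁ * Complex.I) = ∫ x : ℝ, g (x + y₂ * Complex.I) := by
  have hline : ∀ y ∈ uIcc y₁ y₂, Integrable fun x : ℝ => g (x + y * Complex.I) := by
    intro y hy
    refine hBi.mono' (Continuous.aestronglyMeasurable ?_) (ae_of_all _ fun x => ?_)
    · refine continuous_iff_continuousAt.2 fun x => ?_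
      exact ContinuousAt.comp (f := fun x : ℝ => (x : ℂ) + y * Complex.I)
        (hg _ (by simpa using hy)).continuousAt (by fun_prop)
    · simpa using hB (x + y * Complex.I) (by simpa using hy)
  have hside : ∀ {l : Filter ℝ}, Tendsto B l (𝓝 0) → Tendsto
      (fun R : ℝ => ∫ y : ℝ in y₁..y₂, g ((R : ℂ) + y * Complex.I)) l (𝓝 0) := by
    intro l hl
    refine squeeze_zero_norm (a := fun R => B R * |y₂ - y₁|) (fun R => ?_) (by
      simpa using hl.mul_const |y₂ - y₁|)
    refine intervalIntegral.norm_integral_le_of_norm_le_const fun y hy => ?_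
    simpa using hB ((R : ℂ) + y * Complex.I) (by simpa using uIoc_subset_uIcc hy)
  have hlim : ∀ y ∈ uIcc y₁ y₂, Tendsto
      (fun R : ℝ => ∫ x : ℝ in (-R)..R, g (x + y * Complex.I)) atTop
      (𝓝 (∫ x : ℝ, g (x + y * Complex.I))) := fun y hy =>
    intervalIntegral_tendsto_integral (hline y hy) tendsto_neg_atTop_atBot tendsto_id
  have hrect : ∀ R : ℝ, (∫ x : ℝ in (-R)..R, g (x + y₁ * Complex.I)) -
      (∫ x : ℝ in (-R)..R, g (x + y₂ * Complex.I)) +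
      Complex.I • (∫ y : ℝ in y₁..y₂, g ((R : ℂ) + y * Complex.I)) -
      Complex.I • (∫ y : ℝ in y₁..y₂, g (((-R : ℝ) : ℂ) + y * Complex.I)) = 0 := by
    intro R
    simpa using Complex.integral_boundary_rect_eq_zero_of_differentiableOn g
      ⟨-R, y₁⟩ ⟨R, y₂⟩ fun z hz => (hg z hz.2).differentiableWithinAt
  have h := (((hlim y₁ left_mem_uIcc).sub (hlim y₂ right_mem_uIcc)).add
    ((hside htop).const_smul Complex.I)).sub
    (((hside hbot).comp tendsto_neg_atTop_atBot).const_smul Complex.I)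
  have h0 := tendsto_nhds_unique (h.congr hrect) tendsto_const_nhds
  simpa [sub_eq_zero] using h0

lemma integral_comp_exp_mul (f : ℝ → ℂ) :
    ∫ x : ℝ, f (Real.exp x) * Real.exp x = ∫ r in Ioi (0 : ℝ), f r := by
  have h := integral_image_eq_integral_abs_deriv_smul (s := univ) MeasurableSet.univ
    (fun x _ => (Real.hasDerivAt_exp x).hasDerivWithinAt) Real.exp_injective.injOn f
  rw [image_univ, Real.range_exp] at h
  simp [h, mul_comm]

/-- Rotation of a ray of integration for a function decaying exponentially on the closed sector
between the two rays. -/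
lemma integral_ray_eq {f : ℂ → ℂ} {θ₁ θ₂ M c : ℝ} (hc : 0 < c)
    (hf : ∀ r : ℝ, 0 < r → ∀ θ ∈ uIcc θ₁ θ₂,
      DifferentiableAt ℂ f (r * Complex.exp (θ * Complex.I)))
    (hM : ∀ r : ℝ, 0 < r → ∀ θ ∈ uIcc θ₁ θ₂,
      ‖f (r * Complex.exp (θ * Complex.I))‖ ≤ M * Real.exp (-c * r)) :
    ∫ r in Ioi (0 : ℝ), f (r * Complex.exp (θ₁ * Complex.I)) * Complex.exp (θ₁ * Complex.I) =
      ∫ r in Ioi (0 : ℝ), f (r * Complex.exp (θ₂ * Complex.I)) * Complex.exp (θ₂ * Complex.I) := by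
  have hexp : ∀ z : ℂ, Complex.exp z = (Real.exp z.re : ℝ) * Complex.exp (z.im * Complex.I) := by
    intro z
    rw [Complex.ofReal_exp, ← Complex.exp_add, Complex.re_add_im]
  have key := integral_horizontal_line_eq (g := fun z => f (Complex.exp z) * Complex.exp z)
    (y₁ := θ₁) (y₂ := θ₂) (B := fun x => M * (Real.exp x * Real.exp (-c * Real.exp x)))
    ?_ ?_ ?_ ?_ ?_
  · have hconv : ∀ θ : ℝ, ∫ x : ℝ, f (Complex.exp (x + θ * Complex.I)) *
        Complex.exp (x + θ * Complex.I) =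
        ∫ r in Ioi (0 : ℝ), f (r * Complex.exp (θ * Complex.I)) * Complex.exp (θ * Complex.I) := by
      intro θ
      rw [← integral_comp_exp_mul]
      refine integral_congr_ae (ae_of_all _ fun x => ?_)
      simp only [Complex.exp_add, Complex.ofReal_exp]
      ring
    rw [← hconv, ← hconv]
    exact key
  · intro z hz
    have := hf (Real.exp z.re) (Real.exp_pos _) z.im hz
    rw [← hexp] at this
    exact (this.comp z Complex.differentiableAt_exp).mul Complex.differentiableAt_exp
  · intro z hz
    have := hM (Real.exp z.re) (Real.exp_pos _) z.im hz
    rw [← hexp] at this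
    rw [norm_mul, Complex.norm_exp]
    calc _ ≤ M * Real.exp (-c * Real.exp z.re) * Real.exp z.re := by gcongr
      _ = _ := by ring
  · have h := (integrableOn_image_iff_integrableOn_abs_deriv_smul (s := univ) MeasurableSet.univ
      (fun x _ => (Real.hasDerivAt_exp x).hasDerivWithinAt) Real.exp_injective.injOn
      (fun r => Real.exp (-c * r))).1 (by
        rw [image_univ, Real.range_exp]; exact exp_neg_integrableOn_Ioi 0 hc)
    simp only [Real.abs_exp, smul_eq_mul, integrableOn_univ] at h
    exact h.const_mul M
  · have h : Tendsto (fun x : ℝ => x * Real.exp (-c * x)) atTop (𝓝 0) := by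
      simpa using tendsto_rpow_mul_exp_neg_mul_atTop_nhds_zero 1 c hc
    simpa using (h.comp Real.tendsto_exp_atTop).const_mul M
  · have h : Tendsto (fun x : ℝ => x * Real.exp (-c * x)) (𝓝 0) (𝓝 0) := by
      have : Continuous fun x : ℝ => x * Real.exp (-c * x) := by fun_prop
      simpa using this.tendsto 0
    simpa using (h.comp Real.tendsto_exp_atBot).const_mul M

/-- The genus-two Weierstrass factor `(1 + y) e^{-y + y²/2}`. -/
noncomputable def edgeFactor (y : ℂ) : ℂ := (1 + y) * Complex.exp (-y + y ^ 2 / 2)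

lemma norm_edgeFactor (y : ℂ) :
    ‖edgeFactor y‖ = ‖1 + y‖ * Real.exp (-y.re + (y.re ^ 2 - y.im ^ 2) / 2) := by
  rw [edgeFactor, norm_mul, Complex.norm_exp]
  congr 2
  have : (y ^ 2 / 2).re = (y.re ^ 2 - y.im ^ 2) / 2 := by
    rw [show (2 : ℂ) = ((2 : ℝ) : ℂ) by norm_num, Complex.div_ofReal_re]
    simp [pow_two]
  simp [this]

lemma norm_one_add_sq (y : ℂ) : ‖1 + y‖ ^ 2 = (1 + y.re) ^ 2 + y.im ^ 2 := by
  rw [← Complex.normSq_eq_norm_sq, Complex.normSq_apply]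
  simp
  ring

lemma one_add_le_exp_cubic {p : ℝ} (hp : 0 ≤ p) :
    1 + p ≤ Real.exp (p - p ^ 2 / 2 + p ^ 3 / 2) := by
  have h0 : 0 ≤ p - p ^ 2 / 2 + p ^ 3 / 2 := by nlinarith [mul_nonneg hp (sq_nonneg (p - 1))]
  refine le_trans ?_ (Real.quadratic_le_exp_of_nonneg h0)
  have : 1 + (p - p ^ 2 / 2 + p ^ 3 / 2) + (p - p ^ 2 / 2 + p ^ 3 / 2) ^ 2 / 2 - (1 + p) =
    p ^ 4 / 8 * ((p - 1) ^ 2 + 4) := by ring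
  nlinarith [show 0 ≤ p ^ 4 / 8 * ((p - 1) ^ 2 + 4) by positivity]

/-- Gaussian decay of the factor on vertical lines slightly to the right of the origin. -/
lemma norm_edgeFactor_le_of_re {y : ℂ} (h0 : 0 ≤ y.re) (h1 : y.re ≤ 1) :
    ‖edgeFactor y‖ ≤ Real.exp (y.re ^ 3 / 2 - y.re * y.im ^ 2 / 4) := by
  set p := y.re
  set q := y.im
  have hA : (1 + p) ^ 2 ≤ Real.exp (2 * (p - p ^ 2 / 2 + p ^ 3 / 2)) := by
    rw [two_mul, Real.exp_add, ← pow_two]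
    exact pow_le_pow_left₀ (by linarith) (one_add_le_exp_cubic h0) 2
  have hB : 1 + (1 - p / 2) * q ^ 2 ≤ Real.exp ((1 - p / 2) * q ^ 2) := by
    linarith [Real.add_one_le_exp ((1 - p / 2) * q ^ 2)]
  have hC : ‖1 + y‖ ^ 2 ≤ (1 + p) ^ 2 * (1 + (1 - p / 2) * q ^ 2) := by
    rw [norm_one_add_sq]
    have : 1 ≤ (1 + p) ^ 2 * (1 - p / 2) := by
      nlinarith [mul_nonneg h0 (sub_nonneg.2 h1), mul_nonneg h0 (mul_nonneg h0 (sub_nonneg.2 h1))]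
    nlinarith [mul_le_mul_of_nonneg_right this (sq_nonneg q)]
  refine le_of_sq_le_sq ?_ (Real.exp_nonneg _)
  rw [norm_edgeFactor, mul_pow, ← Real.exp_nat_mul, ← Real.exp_nat_mul]
  calc ‖1 + y‖ ^ 2 * Real.exp ((2 : ℕ) * (-p + (p ^ 2 - q ^ 2) / 2))
      ≤ (Real.exp (2 * (p - p ^ 2 / 2 + p ^ 3 / 2)) * Real.exp ((1 - p / 2) * q ^ 2)) *
        Real.exp ((2 : ℕ) * (-p + (p ^ 2 - q ^ 2) / 2)) := by
        gcongr
        refine hC.trans (mul_le_mul hA hB ?_ (Real.exp_nonneg _))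
        have : 0 ≤ 1 - p / 2 := by linarith
        positivity
    _ = _ := by
        rw [← Real.exp_add, ← Real.exp_add]
        congr 1
        push_cast
        ring

/-- Uniform Gaussian decay of the factor on the closed strip `0 ≤ re y ≤ 1`. -/
lemma norm_edgeFactor_le_gaussian {y : ℂ} (h0 : 0 ≤ y.re) (h1 : y.re ≤ 1) :
    ‖edgeFactor y‖ ≤ 3 * Real.exp (-(y.im ^ 2 / 4)) := by
  rw [norm_edgeFactor]
  have hn : ‖1 + y‖ ≤ 3 * Real.exp (y.im ^ 2 / 4) := by
    have h2 : ‖1 + y‖ ≤ 2 + |y.im| := by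
      refine (norm_add_le _ _).trans ?_
      have := Complex.norm_le_abs_re_add_abs_im y
      rw [abs_of_nonneg h0] at this
      simp only [norm_one]
      linarith
    have h3 := Real.add_one_le_exp (y.im ^ 2 / 4)
    nlinarith [sq_nonneg (|y.im| - 2), sq_abs y.im, sq_nonneg y.im]
  calc _ ≤ 3 * Real.exp (y.im ^ 2 / 4) * Real.exp (-(y.im ^ 2 / 2)) := by
        gcongr
        nlinarith
    _ = _ := by
        rw [mul_assoc, ← Real.exp_add]
        ring_nf

lemma two_thirds_cube_le_log {q : ℝ} (h0 : 0 ≤ q) (h1 : q ≤ 1) :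
    2 / 3 * q ^ 3 ≤ Real.log ((1 - q) ^ 2 + q ^ 2) / 2 + q := by
  have hX : ∀ q : ℝ, 0 < (1 - q) ^ 2 + q ^ 2 := fun q => by nlinarith [sq_nonneg (2 * q - 1)]
  have hd : ∀ q : ℝ, HasDerivAt
      (fun q : ℝ => Real.log ((1 - q) ^ 2 + q ^ 2) / 2 + q - 2 / 3 * q ^ 3)
      (2 * q ^ 2 * (1 / ((1 - q) ^ 2 + q ^ 2) - 1)) q := by
    intro q
    have hq : HasDerivAt (fun q : ℝ => (1 - q) ^ 2 + q ^ 2) (4 * q - 2) q := by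
      have := (((hasDerivAt_id q).const_sub 1).pow 2).add ((hasDerivAt_id q).pow 2)
      convert! this using 1
      simp
      ring
    have := (((hq.log (hX q).ne').div_const 2).add (hasDerivAt_id q)).sub
      (((hasDerivAt_id q).pow 3).const_mul (2 / 3))
    convert! this using 1
    have := (hX q).ne'
    simp
    field_simp
    ring
  have hmono : MonotoneOn
      (fun q : ℝ => Real.log ((1 - q) ^ 2 + q ^ 2) / 2 + q - 2 / 3 * q ^ 3) (Icc 0 1) := by
    refine monotoneOn_of_deriv_nonneg (convex_Icc 0 1)
      (fun q _ => (hd q).continuousAt.continuousWithinAt)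
      (fun q _ => (hd q).differentiableAt.differentiableWithinAt) fun q hq => ?_
    rw [interior_Icc] at hq
    rw [(hd q).deriv]
    have : 1 ≤ 1 / ((1 - q) ^ 2 + q ^ 2) := by
      rw [le_div_iff₀ (hX q)]
      nlinarith [hq.1, hq.2]
    have := sub_nonneg.2 this
    positivity
  have := hmono (left_mem_Icc.2 zero_le_one) ⟨h0, h1⟩ h0
  simp at this
  linarith

/-- Exponential growth of the factor on the rays `arg y = ±3π/4`. -/
lemma exp_le_norm_edgeFactor {y : ℂ} {ε : ℝ} (hre : y.re ≤ 0) (him : y.im ^ 2 = y.re ^ 2)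
    (hε0 : 0 ≤ ε) (hε : ε ≤ 1 / 2) :
    Real.exp (2 * ε ^ 2 * (-y.re) - 4 / 3 * ε ^ 3) ≤ ‖edgeFactor y‖ := by
  obtain ⟨q, hq⟩ : ∃ q, q = -y.re := ⟨_, rfl⟩
  have hre' : y.re = -q := by linarith
  have hq0 : 0 ≤ q := by linarith
  have hX : 0 < (1 - q) ^ 2 + q ^ 2 := by nlinarith [sq_nonneg (2 * q - 1)]
  have hn : ‖1 + y‖ = Real.exp (Real.log ((1 - q) ^ 2 + q ^ 2) / 2) := by
    refine (sq_eq_sq₀ (norm_nonneg _) (Real.exp_nonneg _)).1 ?_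
    rw [norm_one_add_sq, ← Real.exp_nat_mul, him, hre', Nat.cast_two,
      mul_div_cancel₀ _ two_ne_zero, Real.exp_log hX]
    ring
  rw [norm_edgeFactor, hn, ← Real.exp_add, him, hre']
  refine Real.exp_le_exp.2 ?_
  have hε2 : ε ^ 2 ≤ 1 / 4 := by nlinarith
  rcases le_total q 1 with h1 | h1
  · have := two_thirds_cube_le_log hq0 h1
    nlinarith [mul_nonneg (add_nonneg hq0 (mul_nonneg zero_le_two hε0)) (sq_nonneg (q - ε))]
  · have := Real.log_nonneg (show 1 ≤ (1 - q) ^ 2 + q ^ 2 by nlinarith)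
    nlinarith [pow_nonneg hε0 3, mul_le_mul_of_nonneg_right hε2 hq0]

/-- A crude lower bound for the factor on the sectors `3π/4 ≤ |arg y| ≤ 5π/6`. -/
lemma half_exp_le_norm_edgeFactor {y : ℂ} (h1 : y.im ^ 2 ≤ y.re ^ 2)
    (h2 : y.re ^ 2 ≤ 3 * y.im ^ 2) :
    1 / 2 * Real.exp (-y.re) ≤ ‖edgeFactor y‖ := by
  rw [norm_edgeFactor]
  have hn : 1 / 2 ≤ ‖1 + y‖ := by
    refine le_of_sq_le_sq ?_ (norm_nonneg _)
    rw [norm_one_add_sq]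
    nlinarith [sq_nonneg (4 * y.re + 3)]
  gcongr
  linarith

/-- The product of the factors `edgeFactor (ζ / x j)`. -/
noncomputable def edgeProduct {n : ℕ} (x : Fin n → ℝ) (ζ : ℂ) : ℂ := ∏ j, edgeFactor (ζ / x j)

lemma differentiable_edgeFactor : Differentiable ℂ edgeFactor := by
  unfold edgeFactor
  fun_prop

lemma differentiable_edgeProduct {n : ℕ} (x : Fin n → ℝ) : Differentiable ℂ (edgeProduct x) := by
  unfold edgeProduct
  exact Differentiable.fun_finsetProd fun j _ =>
    differentiable_edgeFactor.comp (differentiable_id.div_const _)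

section EdgeProduct

variable {n : ℕ} {x : Fin n → ℝ} {D : ℝ}

lemma norm_edgeProduct_le_of_re_eq (hx : ∀ j, 0 < x j) (hD : 0 < D)
    (hD3 : D ^ 3 = ∑ j, 1 / x j ^ 3) (hDx : ∀ j, 2 ≤ D * x j) {ω : ℂ} (hω : ω.re = 1 / D) :
    ‖edgeProduct x ω‖ ≤ Real.exp (1 / 2) * Real.exp (-(D ^ 2 / 4) * ω.im ^ 2) := by
  rw [edgeProduct, norm_prod]
  have hfac : ∀ j ∈ Finset.univ, ‖edgeFactor (ω / x j)‖ ≤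
      Real.exp ((1 / (2 * D ^ 3) - ω.im ^ 2 / (4 * D)) * (1 / x j ^ 3)) := by
    intro j _
    have hxj := hx j
    have hDxj := hDx j
    refine (norm_edgeFactor_le_of_re ?_ ?_).trans (le_of_eq ?_)
    · rw [Complex.div_ofReal_re, hω]; positivity
    · rw [Complex.div_ofReal_re, hω, div_div, div_le_one (by positivity)]; linarith
    · rw [Complex.div_ofReal_re, Complex.div_ofReal_im, hω]
      congr 1
      field_simp
  refine (Finset.prod_le_prod (fun _ _ => norm_nonneg _) hfac).trans (le_of_eq ?_)
  rw [← Real.exp_sum, ← Finset.mul_sum, ← hD3, ← Real.exp_add]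
  congr 1
  field_simp
  ring

lemma norm_edgeProduct_le_gaussian (hx : ∀ j, 0 < x j) (hD : 0 < D)
    (hDx : ∀ j, 2 ≤ D * x j) {ω : ℂ} (h0 : 0 ≤ ω.re) (h1 : ω.re ≤ 1 / D) :
    ‖edgeProduct x ω‖ ≤ 3 ^ n * Real.exp (-(∑ j, 1 / (4 * x j ^ 2)) * ω.im ^ 2) := by
  rw [edgeProduct, norm_prod]
  have hfac : ∀ j ∈ Finset.univ, ‖edgeFactor (ω / x j)‖ ≤
      3 * Real.exp (-ω.im ^ 2 * (1 / (4 * x j ^ 2))) := by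
    intro j _
    have hxj := hx j
    have hDxj := hDx j
    refine (norm_edgeFactor_le_gaussian ?_ ?_).trans (le_of_eq ?_)
    · rw [Complex.div_ofReal_re]; positivity
    · rw [Complex.div_ofReal_re, div_le_one hxj]
      refine h1.trans ?_
      rw [div_le_iff₀ hD]
      linarith
    · rw [Complex.div_ofReal_im]
      congr 2
      field_simp
  refine (Finset.prod_le_prod (fun _ _ => norm_nonneg _) hfac).trans (le_of_eq ?_)
  rw [Finset.prod_mul_distrib, ← Real.exp_sum, ← Finset.mul_sum]
  simp only [Finset.prod_const, Finset.card_univ, Fintype.card_fin]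
  congr 2
  ring

lemma exp_le_norm_edgeProduct (hx : ∀ j, 0 < x j) (hD : 0 < D)
    (hD3 : D ^ 3 = ∑ j, 1 / x j ^ 3) (hDx : ∀ j, 2 ≤ D * x j) {ζ : ℂ} (hre : ζ.re ≤ 0)
    (him : ζ.im ^ 2 = ζ.re ^ 2) :
    Real.exp (2 * D * (-ζ.re) - 4 / 3) ≤ ‖edgeProduct x ζ‖ := by
  rw [edgeProduct, norm_prod]
  have hfac : ∀ j ∈ Finset.univ,
      Real.exp ((2 * (-ζ.re) / D ^ 2 - 4 / (3 * D ^ 3)) * (1 / x j ^ 3)) ≤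
        ‖edgeFactor (ζ / x j)‖ := by
    intro j _
    have hxj := hx j
    have hDxj := hDx j
    refine le_trans (le_of_eq ?_) (exp_le_norm_edgeFactor (ε := 1 / (D * x j)) ?_ ?_ ?_ ?_)
    · rw [Complex.div_ofReal_re]
      congr 1
      field_simp
    · rw [Complex.div_ofReal_re]
      exact div_nonpos_of_nonpos_of_nonneg hre hxj.le
    · rw [Complex.div_ofReal_re, Complex.div_ofReal_im, div_pow, div_pow, him]
    · positivity
    · rw [div_le_div_iff₀ (by positivity) two_pos]
      linarith
  refine le_trans (le_of_eq ?_) (Finset.prod_le_prod (fun _ _ => Real.exp_nonneg _) hfac)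
  rw [← Real.exp_sum, ← Finset.mul_sum, ← hD3]
  congr 1
  field_simp

lemma half_exp_le_norm_edgeProduct {ζ : ℂ} (h1 : ζ.im ^ 2 ≤ ζ.re ^ 2)
    (h2 : ζ.re ^ 2 ≤ 3 * ζ.im ^ 2) :
    (1 / 2) ^ n * Real.exp ((∑ j, 1 / x j) * (-ζ.re)) ≤ ‖edgeProduct x ζ‖ := by
  rw [edgeProduct, norm_prod]
  have hfac : ∀ j ∈ Finset.univ, 1 / 2 * Real.exp (-ζ.re * (1 / x j)) ≤
      ‖edgeFactor (ζ / x j)‖ := by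
    intro j _
    refine le_trans (le_of_eq ?_) (half_exp_le_norm_edgeFactor ?_ ?_)
    · rw [Complex.div_ofReal_re]
      congr 2
      ring
    · rw [Complex.div_ofReal_re, Complex.div_ofReal_im, div_pow, div_pow]
      gcongr
    · rw [Complex.div_ofReal_re, Complex.div_ofReal_im, div_pow, div_pow, ← mul_div_assoc]
      gcongr
  refine le_trans (le_of_eq ?_) (Finset.prod_le_prod (fun _ _ => by positivity) hfac)
  rw [Finset.prod_mul_distrib, ← Real.exp_sum, ← Finset.mul_sum]
  simp only [Finset.prod_const, Finset.card_univ, Fintype.card_fin]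
  congr 2
  ring

end EdgeProduct

/-- The integrand of the edge double integral in coordinates centred at the critical point. -/
noncomputable def edgeKernel {n : ℕ} (x : Fin n → ℝ) (u : ℝ) (ζ ω : ℂ) : ℂ :=
  Complex.exp (u * (ζ - ω)) / (ω - ζ) * (edgeProduct x ω / edgeProduct x ζ)

lemma cos_sin_sector {σ θ : ℝ} (hσ : σ = 1 ∨ σ = -1)
    (hθ : θ ∈ uIcc (σ * (5 * π / 6)) (σ * (3 * π / 4))) :
    Real.cos θ ≤ -1 / 2 ∧ Real.sin θ ^ 2 ≤ Real.cos θ ^ 2 ∧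
      Real.cos θ ^ 2 ≤ 3 * Real.sin θ ^ 2 := by
  have hpi := Real.pi_pos
  have habs : 3 * π / 4 ≤ |θ| ∧ |θ| ≤ 5 * π / 6 := by
    rcases hσ with rfl | rfl
    · rw [one_mul, one_mul, uIcc_of_ge (by linarith)] at hθ
      rw [abs_of_nonneg (by linarith [hθ.1])]
      exact hθ
    · rw [uIcc_of_le (by linarith)] at hθ
      rw [abs_of_nonpos (by linarith [hθ.2])]
      constructor <;> linarith [hθ.1, hθ.2]
  have h1 : Real.cos θ ≤ -(√2 / 2) := by
    rw [← Real.cos_abs θ, ← Real.cos_pi_div_four, ← Real.cos_pi_sub]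
    exact Real.cos_le_cos_of_nonneg_of_le_pi (by linarith) (by linarith) (by linarith)
  have h2 : -(√3 / 2) ≤ Real.cos θ := by
    rw [← Real.cos_abs θ, ← Real.cos_pi_div_six, ← Real.cos_pi_sub]
    exact Real.cos_le_cos_of_nonneg_of_le_pi (by positivity) (by linarith) (by linarith)
  have h2s : √2 ^ 2 = 2 := Real.sq_sqrt (by norm_num)
  have h3s : √3 ^ 2 = 3 := Real.sq_sqrt (by norm_num)
  have h20 := Real.sqrt_nonneg 2
  have h30 := Real.sqrt_nonneg 3
  have hsc := Real.sin_sq_add_cos_sq θ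
  refine ⟨?_, ?_, ?_⟩ <;> nlinarith

section EdgeKernel

variable {n : ℕ} {x : Fin n → ℝ} {D u : ℝ}

lemma norm_edgeKernel_le (hx : ∀ j, 0 < x j) (hD : 0 < D)
    (hD3 : D ^ 3 = ∑ j, 1 / x j ^ 3) (hDx : ∀ j, 2 ≤ D * x j) (hu : 0 ≤ u) {ζ ω : ℂ} {L : ℝ}
    (hζ : ζ.re ≤ 0) (hω : ω.re = 1 / D) (hL : 0 < L) (hLζ : L ≤ ‖edgeProduct x ζ‖) :
    ‖edgeKernel x u ζ ω‖ ≤ Real.exp (-u / D) * D *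
      (Real.exp (1 / 2) * Real.exp (-(D ^ 2 / 4) * ω.im ^ 2)) * L⁻¹ := by
  rw [edgeKernel, norm_mul, norm_div, norm_div, Complex.norm_exp, div_eq_mul_inv,
    div_eq_mul_inv, mul_assoc _ (Real.exp (1 / 2) * _), mul_assoc (Real.exp (1 / 2))]
  have h1 : ((u : ℂ) * (ζ - ω)).re ≤ -u / D := by
    rw [Complex.re_ofReal_mul, Complex.sub_re, hω]
    have := mul_nonneg hu (neg_nonneg.2 hζ)
    linarith [show -u / D = -(u * (1 / D)) by ring]
  have h2 : ‖ω - ζ‖⁻¹ ≤ D := by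
    refine inv_le_of_inv_le₀ hD (le_trans ?_ (Complex.re_le_norm _))
    rw [Complex.sub_re, hω, one_div]
    linarith
  have h3 := norm_edgeProduct_le_of_re_eq hx hD hD3 hDx hω
  rw [← mul_assoc (Real.exp (1 / 2))]
  gcongr

lemma norm_edgeKernel_le_gaussian (hx : ∀ j, 0 < x j) (hD : 0 < D)
    (hDx : ∀ j, 2 ≤ D * x j) (hu : 0 ≤ u) {ζ ω : ℂ}
    (hζ : ζ.re < 0) (h0 : 0 ≤ ω.re) (h1 : ω.re ≤ 1 / D) :
    ‖edgeKernel x u ζ ω‖ ≤ (-ζ.re)⁻¹ * (3 ^ n * ‖edgeProduct x ζ‖⁻¹) *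
      Real.exp (-(∑ j, 1 / (4 * x j ^ 2)) * ω.im ^ 2) := by
  rw [edgeKernel, norm_mul, norm_div, norm_div, Complex.norm_exp]
  have h2 : Real.exp ((u : ℂ) * (ζ - ω)).re ≤ 1 := by
    rw [Real.exp_le_one_iff, Complex.re_ofReal_mul, Complex.sub_re]
    exact mul_nonpos_of_nonneg_of_nonpos hu (by linarith)
  have h3 : -ζ.re ≤ ‖ω - ζ‖ := by
    refine le_trans ?_ (Complex.re_le_norm _)
    rw [Complex.sub_re]
    linarith
  have h4 : 0 < -ζ.re := neg_pos.2 hζ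
  calc _ ≤ 1 / (-ζ.re) * (3 ^ n * Real.exp (-(∑ j, 1 / (4 * x j ^ 2)) * ω.im ^ 2) /
        ‖edgeProduct x ζ‖) := by
        gcongr
        exact norm_edgeProduct_le_gaussian hx hD hDx h0 h1
    _ = _ := by ring

/-- The vertical line of integration may be moved to the right by `1 / D`. -/
lemma integral_edgeKernel_shift (hn : 1 ≤ n) (hx : ∀ j, 0 < x j) (hD : 0 < D)
    (hDx : ∀ j, 2 ≤ D * x j) (hu : 0 ≤ u) {ζ : ℂ} (hζ : ζ.re < 0) :
    ∫ s : ℝ, edgeKernel x u ζ (s * Complex.I) =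
      ∫ s : ℝ, edgeKernel x u ζ ((1 / D : ℝ) + s * Complex.I) := by
  have : Nonempty (Fin n) := ⟨⟨0, hn⟩⟩
  have hκ : 0 < ∑ j, 1 / (4 * x j ^ 2) :=
    Finset.sum_pos (fun j _ => by have := hx j; positivity) Finset.univ_nonempty
  have hD' : 0 < 1 / D := by positivity
  have hmem : ∀ z : ℂ, z.im ∈ uIcc 0 (-(1 / D)) →
      0 ≤ (Complex.I * z).re ∧ (Complex.I * z).re ≤ 1 / D := by
    intro z hz
    rw [uIcc_of_ge (by linarith)] at hz
    simp only [Complex.I_mul_re]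
    constructor <;> linarith [hz.1, hz.2]
  have hBi := (integrable_exp_neg_mul_sq hκ).const_mul
    ((-ζ.re)⁻¹ * (3 ^ n * ‖edgeProduct x ζ‖⁻¹))
  have hsq : ∀ {l : Filter ℝ}, Tendsto (fun s : ℝ => s ^ 2) l atTop →
      Tendsto (fun s : ℝ => (-ζ.re)⁻¹ * (3 ^ n * ‖edgeProduct x ζ‖⁻¹) *
        Real.exp (-(∑ j, 1 / (4 * x j ^ 2)) * s ^ 2)) l (𝓝 0) := by
    intro l hl
    have h : Tendsto (fun s : ℝ => Real.exp (-(∑ j, 1 / (4 * x j ^ 2)) * s ^ 2)) l (𝓝 0) :=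
      Real.tendsto_exp_atBot.comp (hl.const_mul_atTop_of_neg (neg_neg_of_pos hκ))
    simpa using h.const_mul ((-ζ.re)⁻¹ * (3 ^ n * ‖edgeProduct x ζ‖⁻¹))
  have key := integral_horizontal_line_eq (g := fun z => edgeKernel x u ζ (Complex.I * z))
    (y₁ := 0) (y₂ := -(1 / D)) ?_ ?_ hBi
    (hsq (tendsto_pow_atTop two_ne_zero)) (hsq (by
      simpa [Function.comp_def] using
        (tendsto_pow_atTop (α := ℝ) two_ne_zero).comp tendsto_abs_atBot_atTop))
  · have e1 : ∀ s : ℝ, Complex.I * ((s : ℂ) + ((0 : ℝ) : ℂ) * Complex.I) = s * Complex.I := by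
      intro s
      push_cast
      ring
    have e2 : ∀ s : ℝ, Complex.I * ((s : ℂ) + ((-(1 / D) : ℝ) : ℂ) * Complex.I) =
        ((1 / D : ℝ) : ℂ) + s * Complex.I := by
      intro s
      rw [Complex.ofReal_neg]
      linear_combination (-((1 / D : ℝ) : ℂ)) * Complex.I_mul_I
    simpa only [e1, e2] using key
  · intro z hz
    have hne : Complex.I * z - ζ ≠ 0 := by
      intro h
      have := congrArg Complex.re h
      rw [Complex.sub_re, Complex.zero_re] at this
      linarith [(hmem z hz).1]
    have hP := (differentiable_edgeProduct x).differentiableAt (x := Complex.I * z)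
    have hI : DifferentiableAt ℂ (fun z : ℂ => Complex.I * z) z := by fun_prop
    have hP' : DifferentiableAt ℂ (fun z : ℂ => edgeProduct x (Complex.I * z)) z := hP.comp z hI
    have hnum : DifferentiableAt ℂ (fun z => Complex.exp (u * (ζ - Complex.I * z))) z := by fun_prop
    exact (hnum.div (hI.sub_const ζ) hne).mul (hP'.div_const _)
  · intro z hz
    have := norm_edgeKernel_le_gaussian hx hD hDx hu hζ (hmem z hz).1 (hmem z hz).2
    rwa [Complex.I_mul_im] at this

lemma ray_re (r θ : ℝ) : ((r : ℂ) * Complex.exp (θ * Complex.I)).re = r * Real.cos θ := by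
  rw [Complex.re_ofReal_mul, Complex.exp_ofReal_mul_I_re]

lemma ray_im (r θ : ℝ) : ((r : ℂ) * Complex.exp (θ * Complex.I)).im = r * Real.sin θ := by
  rw [Complex.im_ofReal_mul, Complex.exp_ofReal_mul_I_im]

lemma norm_edgeKernel_ray_le (hx : ∀ j, 0 < x j) (hD : 0 < D)
    (hD3 : D ^ 3 = ∑ j, 1 / x j ^ 3) (hDx : ∀ j, 2 ≤ D * x j) (hu : 0 ≤ u) {r θ : ℝ}
    (hr : 0 < r) (hθ : Real.cos θ ≤ -1 / 2 ∧ Real.sin θ ^ 2 ≤ Real.cos θ ^ 2 ∧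
      Real.cos θ ^ 2 ≤ 3 * Real.sin θ ^ 2) {ω : ℂ} (hω : ω.re = 1 / D) :
    ‖edgeKernel x u (r * Complex.exp (θ * Complex.I)) ω‖ ≤ Real.exp (-u / D) * D *
      (Real.exp (1 / 2) * Real.exp (-(D ^ 2 / 4) * ω.im ^ 2)) *
      (2 ^ n * Real.exp (-((∑ j, 1 / x j) / 2) * r)) := by
  have hT : 0 ≤ ∑ j, 1 / x j := Finset.sum_nonneg fun j _ => by have := hx j; positivity
  have hL : 0 < (1 / 2 : ℝ) ^ n * Real.exp ((∑ j, 1 / x j) / 2 * r) := by positivity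
  refine (norm_edgeKernel_le hx hD hD3 hDx hu ?_ hω hL ?_).trans (le_of_eq ?_)
  · rw [ray_re]
    exact mul_nonpos_of_nonneg_of_nonpos hr.le (by linarith [hθ.1])
  · refine le_trans ?_ (half_exp_le_norm_edgeProduct ?_ ?_)
    · rw [ray_re, div_mul_eq_mul_div, mul_div_assoc]
      gcongr
      nlinarith [hθ.1]
    · rw [ray_re, ray_im, mul_pow, mul_pow]
      exact mul_le_mul_of_nonneg_left hθ.2.1 (sq_nonneg r)
    · rw [ray_re, ray_im, mul_pow, mul_pow]
      nlinarith [mul_le_mul_of_nonneg_left hθ.2.2 (sq_nonneg r)]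
  · rw [mul_inv, ← Real.exp_neg, one_div, inv_pow, inv_inv, ← neg_mul]

/-- On the rays at angle `±3π/4` the kernel decays on the scale `1 / D`. -/
lemma norm_edgeKernel_diagonal_ray_le (hx : ∀ j, 0 < x j) (hD : 0 < D)
    (hD3 : D ^ 3 = ∑ j, 1 / x j ^ 3) (hDx : ∀ j, 2 ≤ D * x j) (hu : 0 ≤ u) {r θ : ℝ}
    (hr : 0 < r) (hθ : Real.cos θ ≤ -1 / 2) (hθ' : Real.sin θ ^ 2 = Real.cos θ ^ 2)
    {ω : ℂ} (hω : ω.re = 1 / D) :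
    ‖edgeKernel x u (r * Complex.exp (θ * Complex.I)) ω‖ ≤ Real.exp (-u / D) * D *
      (Real.exp (1 / 2) * Real.exp (-(D ^ 2 / 4) * ω.im ^ 2)) *
      (Real.exp (4 / 3) * Real.exp (-D * r)) := by
  have hre : ((r : ℂ) * Complex.exp (θ * Complex.I)).re ≤ 0 := by
    rw [ray_re]
    exact mul_nonpos_of_nonneg_of_nonpos hr.le (by linarith)
  refine (norm_edgeKernel_le hx hD hD3 hDx hu hre hω (Real.exp_pos (D * r - 4 / 3)) ?_).trans
    (le_of_eq ?_)
  · refine le_trans ?_ (exp_le_norm_edgeProduct hx hD hD3 hDx hre ?_)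
    · rw [ray_re]
      refine Real.exp_le_exp.2 ?_
      nlinarith [mul_pos hD hr]
    · rw [ray_re, ray_im, mul_pow, mul_pow, hθ']
  · rw [← Real.exp_neg, ← Real.exp_add (4 / 3)]
    congr 2
    ring

lemma measurable_edgeKernel : Measurable fun p : ℂ × ℂ => edgeKernel x u p.1 p.2 := by
  have hP : Measurable (edgeProduct x) := (differentiable_edgeProduct x).continuous.measurable
  unfold edgeKernel
  fun_prop

lemma integrable_edgeKernel_ray (hn : 1 ≤ n) (hx : ∀ j, 0 < x j) (hD : 0 < D)
    (hD3 : D ^ 3 = ∑ j, 1 / x j ^ 3) (hDx : ∀ j, 2 ≤ D * x j) (hu : 0 ≤ u) {θ : ℝ}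
    (hθ : Real.cos θ ≤ -1 / 2 ∧ Real.sin θ ^ 2 ≤ Real.cos θ ^ 2 ∧
      Real.cos θ ^ 2 ≤ 3 * Real.sin θ ^ 2) :
    Integrable (Function.uncurry fun r s : ℝ => edgeKernel x u (r * Complex.exp (θ * Complex.I))
      ((1 / D : ℝ) + s * Complex.I) * Complex.exp (θ * Complex.I))
      ((volume.restrict (Ioi 0)).prod volume) := by
  have : Nonempty (Fin n) := ⟨⟨0, hn⟩⟩
  have hT : 0 < (∑ j, 1 / x j) / 2 := half_pos <|
    Finset.sum_pos (fun j _ => by have := hx j; positivity) Finset.univ_nonempty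
  have hdom := (((exp_neg_integrableOn_Ioi 0 hT).integrable.mul_prod
    (integrable_exp_neg_mul_sq (show 0 < D ^ 2 / 4 by positivity)))).const_mul
    (Real.exp (-u / D) * D * Real.exp (1 / 2) * 2 ^ n)
  refine hdom.mono' (Measurable.aestronglyMeasurable ?_) ?_
  · refine Measurable.mul_const (measurable_edgeKernel.comp (f := fun p : ℝ × ℝ =>
      ((p.1 : ℂ) * Complex.exp (θ * Complex.I), ((1 / D : ℝ) : ℂ) + p.2 * Complex.I)) ?_) _
    fun_prop
  · have hμ : ((volume : Measure ℝ).restrict (Ioi 0)).prod (volume : Measure ℝ) =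
        (volume.prod volume).restrict (Ioi 0 ×ˢ univ) := by
      rw [← Measure.prod_restrict, Measure.restrict_univ]
    rw [hμ]
    refine ae_restrict_of_forall_mem (measurableSet_Ioi.prod MeasurableSet.univ) fun p hp => ?_
    have h := norm_edgeKernel_ray_le hx hD hD3 hDx hu (mem_Ioi.1 hp.1) hθ
      (ω := ((1 / D : ℝ) : ℂ) + p.2 * Complex.I) (by simp)
    rw [Function.uncurry, norm_mul, Complex.norm_exp_ofReal_mul_I, mul_one]
    refine h.trans (le_of_eq ?_)
    simp
    ring

end EdgeKernel

/-- Bound for the contribution of one ray of the contour to the edge double integral. -/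
lemma edgeKernel_ray_bound {n : ℕ} {x : Fin n → ℝ} {D u : ℝ} (hn : 1 ≤ n) (hx : ∀ j, 0 < x j)
    (hD : 0 < D) (hD3 : D ^ 3 = ∑ j, 1 / x j ^ 3) (hDx : ∀ j, 2 ≤ D * x j) (hu : 0 ≤ u) {σ : ℝ}
    (hσ : σ = 1 ∨ σ = -1) :
    IntegrableOn (fun r : ℝ => (∫ s : ℝ, edgeKernel x u
        (r * Complex.exp ((σ * (5 * π / 6) : ℝ) * Complex.I)) (s * Complex.I)) *
        Complex.exp ((σ * (5 * π / 6) : ℝ) * Complex.I)) (Ioi 0) ∧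
      D * ‖∫ r in Ioi (0 : ℝ), (∫ s : ℝ, edgeKernel x u
        (r * Complex.exp ((σ * (5 * π / 6) : ℝ) * Complex.I)) (s * Complex.I)) *
        Complex.exp ((σ * (5 * π / 6) : ℝ) * Complex.I)‖ ≤
      Real.exp (1 / 2) * Real.exp (4 / 3) * (2 * √π) * Real.exp (-u / D) := by
  set θ := σ * (5 * π / 6) with hθ
  set φ := σ * (3 * π / 4) with hφ
  have hsec : ∀ ψ ∈ uIcc θ φ, _ := fun ψ hψ => cos_sin_sector hσ hψ
  have hθs := hsec θ left_mem_uIcc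
  have hφs := hsec φ right_mem_uIcc
  have hint : ∀ ψ ∈ uIcc θ φ, _ := fun ψ hψ =>
    integrable_edgeKernel_ray hn hx hD hD3 hDx hu (hsec ψ hψ)
  have hshift : ∀ r ∈ Ioi (0 : ℝ), (∫ s : ℝ, edgeKernel x u
      (r * Complex.exp (θ * Complex.I)) (s * Complex.I)) * Complex.exp (θ * Complex.I) =
      ∫ s : ℝ, edgeKernel x u (r * Complex.exp (θ * Complex.I))
        ((1 / D : ℝ) + s * Complex.I) * Complex.exp (θ * Complex.I) := by
    intro r hr
    rw [integral_edgeKernel_shift hn hx hD hDx hu, integral_mul_const]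
    rw [ray_re]
    exact mul_neg_of_pos_of_neg hr (by linarith [hθs.1])
  constructor
  · exact IntegrableOn.congr_fun (hint θ left_mem_uIcc).integral_prod_left
      (fun r hr => (hshift r hr).symm) measurableSet_Ioi
  have hrot : ∀ s : ℝ, ∫ r in Ioi (0 : ℝ), edgeKernel x u (r * Complex.exp (θ * Complex.I))
        ((1 / D : ℝ) + s * Complex.I) * Complex.exp (θ * Complex.I) =
      ∫ r in Ioi (0 : ℝ), edgeKernel x u (r * Complex.exp (φ * Complex.I))
        ((1 / D : ℝ) + s * Complex.I) * Complex.exp (φ * Complex.I) := by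
    intro s
    have : Nonempty (Fin n) := ⟨⟨0, hn⟩⟩
    have hT : 0 < (∑ j, 1 / x j) / 2 := half_pos <|
      Finset.sum_pos (fun j _ => by have := hx j; positivity) Finset.univ_nonempty
    refine integral_ray_eq (f := fun ζ => edgeKernel x u ζ ((1 / D : ℝ) + s * Complex.I))
      (M := Real.exp (-u / D) * D * (Real.exp (1 / 2) * Real.exp (-(D ^ 2 / 4) * s ^ 2)) * 2 ^ n)
      hT (fun r hr ψ hψ => ?_) (fun r hr ψ hψ => ?_)
    · have hre : ((r : ℂ) * Complex.exp (ψ * Complex.I)).re < 0 := by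
        rw [ray_re]
        exact mul_neg_of_pos_of_neg hr (by linarith [(hsec ψ hψ).1])
      have hne : ((1 / D : ℝ) : ℂ) + s * Complex.I - r * Complex.exp (ψ * Complex.I) ≠ 0 := by
        intro h
        have h' := congrArg Complex.re h
        rw [Complex.sub_re] at h'
        simp only [Complex.add_re, Complex.ofReal_re, Complex.mul_re, Complex.I_re, mul_zero,
          Complex.ofReal_im, Complex.I_im, mul_one, sub_self, add_zero, Complex.zero_re] at h'
        simp only [Complex.mul_re, Complex.ofReal_re, Complex.ofReal_im] at hre
        have : 0 < 1 / D := by positivity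
        linarith
      have hP0 : edgeProduct x (r * Complex.exp (ψ * Complex.I)) ≠ 0 := by
        refine norm_pos_iff.1 (lt_of_lt_of_le ?_ (half_exp_le_norm_edgeProduct ?_ ?_))
        · positivity
        · rw [ray_re, ray_im, mul_pow, mul_pow]
          exact mul_le_mul_of_nonneg_left (hsec ψ hψ).2.1 (sq_nonneg r)
        · rw [ray_re, ray_im, mul_pow, mul_pow]
          nlinarith [mul_le_mul_of_nonneg_left (hsec ψ hψ).2.2 (sq_nonneg r)]
      generalize (r : ℂ) * Complex.exp (ψ * Complex.I) = ζ at hne hP0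
      have hnum : DifferentiableAt ℂ (fun ζ : ℂ => Complex.exp
          (u * (ζ - (((1 / D : ℝ) : ℂ) + s * Complex.I)))) ζ := by fun_prop
      exact (hnum.div (differentiableAt_id.const_sub _) hne).mul
        ((differentiableAt_const _).div (differentiable_edgeProduct x ζ) hP0)
    · refine (norm_edgeKernel_ray_le hx hD hD3 hDx hu hr (hsec ψ hψ) (by simp)).trans
        (le_of_eq ?_)
      simp
      ring
  have hswap : (∫ r in Ioi (0 : ℝ), (∫ s : ℝ, edgeKernel x u
      (r * Complex.exp (θ * Complex.I)) (s * Complex.I)) * Complex.exp (θ * Complex.I)) =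
      ∫ s : ℝ, ∫ r in Ioi (0 : ℝ), edgeKernel x u (r * Complex.exp (φ * Complex.I))
        ((1 / D : ℝ) + s * Complex.I) * Complex.exp (φ * Complex.I) := by
    rw [setIntegral_congr_fun measurableSet_Ioi hshift,
      integral_integral_swap (hint θ left_mem_uIcc)]
    exact integral_congr_ae (ae_of_all _ hrot)
  have hφ' : Real.sin φ ^ 2 = Real.cos φ ^ 2 := by
    have h34 : 3 * π / 4 = π - π / 4 := by ring
    rcases hσ with rfl | rfl
    · rw [hφ, one_mul, h34, Real.sin_pi_sub, Real.cos_pi_sub, Real.sin_pi_div_four,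
        Real.cos_pi_div_four, neg_sq]
    · rw [hφ, neg_one_mul, Real.sin_neg, Real.cos_neg, h34, Real.sin_pi_sub, Real.cos_pi_sub,
        Real.sin_pi_div_four, Real.cos_pi_div_four, neg_sq]
  have hinner : ∀ s : ℝ, ‖∫ r in Ioi (0 : ℝ), edgeKernel x u (r * Complex.exp (φ * Complex.I))
        ((1 / D : ℝ) + s * Complex.I) * Complex.exp (φ * Complex.I)‖ ≤
      Real.exp (-u / D) * (Real.exp (1 / 2) * Real.exp (4 / 3)) *
        Real.exp (-(D ^ 2 / 4) * s ^ 2) := by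
    intro s
    have hDint : IntegrableOn (fun r : ℝ => Real.exp (-u / D) * D *
        (Real.exp (1 / 2) * Real.exp (-(D ^ 2 / 4) * s ^ 2)) *
        (Real.exp (4 / 3) * Real.exp (-D * r))) (Ioi 0) :=
      ((exp_neg_integrableOn_Ioi 0 hD).const_mul _).const_mul _
    refine (norm_integral_le_of_norm_le hDint (ae_restrict_of_forall_mem measurableSet_Ioi
      fun r hr => ?_)).trans (le_of_eq ?_)
    · rw [norm_mul, Complex.norm_exp_ofReal_mul_I, mul_one]
      simpa using norm_edgeKernel_diagonal_ray_le hx hD hD3 hDx hu (mem_Ioi.1 hr) hφs.1 hφ'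
        (ω := ((1 / D : ℝ) : ℂ) + s * Complex.I) (by simp)
    · rw [integral_const_mul, integral_const_mul, integral_exp_mul_Ioi (neg_neg_of_pos hD)]
      simp
      field_simp
  rw [hswap]
  have hgauss := integrable_exp_neg_mul_sq (show 0 < D ^ 2 / 4 by positivity)
  refine (mul_le_mul_of_nonneg_left (norm_integral_le_of_norm_le (hgauss.const_mul _)
    (ae_of_all _ hinner)) hD.le).trans (le_of_eq ?_)
  rw [integral_const_mul, integral_gaussian]
  have : √(π / (D ^ 2 / 4)) = 2 * √π / D := by
    rw [show π / (D ^ 2 / 4) = π * (2 / D) ^ 2 by field_simp; norm_num,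
      Real.sqrt_mul Real.pi_pos.le, Real.sqrt_sq (by positivity)]
    ring
  rw [this]
  field_simp

/-- The edge integrand in coordinates centred at the critical point `b`. -/
lemma edge_integrand_eq {n : ℕ} {S b a : ℝ} {ν x : Fin n → ℝ} (hS : S ≠ 0) (hx : ∀ j, x j ≠ 0)
    (hν : ∀ j, ν j = S * (b - x j)) (hS2 : ∑ j, 1 / x j ^ 2 = S)
    (ha : a * S = b * S + ∑ j, 1 / x j) (u : ℝ) (ζ ω : ℂ) :
    Complex.exp ((u : ℂ) * ((b + ζ) - (b + ω))) / ((b + ω) - (b + ζ)) *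
      Complex.exp ((S : ℂ) * ((b + ω) ^ 2 - (b + ζ) ^ 2) / 2 -
        (a : ℂ) * (S : ℂ) * ((b + ω) - (b + ζ))) *
      ∏ j, ((S : ℂ) * (b + ω) - (ν j : ℂ)) / ((S : ℂ) * (b + ζ) - (ν j : ℂ)) =
    edgeKernel x u ζ ω := by
  have hx' : ∀ j, (x j : ℂ) ≠ 0 := fun j => by exact_mod_cast hx j
  have hS' : (S : ℂ) ≠ 0 := by exact_mod_cast hS
  have hS2' : ∑ j, 1 / (x j : ℂ) ^ 2 = (S : ℂ) := by
    have := congrArg Complex.ofReal hS2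
    push_cast at this
    exact this
  have ha' : (a : ℂ) * S = b * S + ∑ j, 1 / (x j : ℂ) := by
    have := congrArg Complex.ofReal ha
    push_cast at this
    exact this
  have hprod : ∏ j, ((S : ℂ) * (b + ω) - (ν j : ℂ)) / ((S : ℂ) * (b + ζ) - (ν j : ℂ)) =
      ∏ j, (1 + ω / x j) / (1 + ζ / x j) := by
    refine Finset.prod_congr rfl fun j _ => ?_
    have hlin : ∀ y : ℂ, (S : ℂ) * (b + y) - (ν j : ℂ) = S * x j * (1 + y / x j) := by
      intro y
      have := hx' j
      rw [hν j]
      push_cast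
      field_simp
      ring
    rw [hlin, hlin, mul_div_mul_left _ _ (mul_ne_zero hS' (hx' j))]
  have hsum : ∀ y : ℂ, ∑ j, (-(y / x j) + (y / x j) ^ 2 / 2) =
      -y * (∑ j, 1 / (x j : ℂ)) + y ^ 2 / 2 * S := by
    intro y
    rw [← hS2', Finset.mul_sum, Finset.mul_sum, ← Finset.sum_add_distrib]
    refine Finset.sum_congr rfl fun j _ => ?_
    ring
  have hP : ∀ y : ℂ, edgeProduct x y =
      (∏ j, (1 + y / x j)) * Complex.exp (-y * (∑ j, 1 / (x j : ℂ)) + y ^ 2 / 2 * S) := by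
    intro y
    rw [← hsum, Complex.exp_sum, ← Finset.prod_mul_distrib]
    rfl
  unfold edgeKernel
  rw [hP, hP, hprod, Finset.prod_div_distrib, mul_div_mul_comm, ← Complex.exp_sub,
    ha', add_sub_add_left_eq_sub, add_sub_add_left_eq_sub, mul_assoc, mul_comm (Complex.exp _)]
  congr 3
  ring

lemma edgeI_bound {n : ℕ} {S b a D u : ℝ} {ν x : Fin n → ℝ} (hn : 1 ≤ n) (hS : S ≠ 0)
    (hx : ∀ j, 0 < x j) (hν : ∀ j, ν j = S * (b - x j)) (hS2 : ∑ j, 1 / x j ^ 2 = S)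
    (ha : a * S = b * S + ∑ j, 1 / x j) (hD : 0 < D) (hD3 : D ^ 3 = ∑ j, 1 / x j ^ 3)
    (hDx : ∀ j, 2 ≤ D * x j) (hu : 0 ≤ u) :
    D * ‖edgeI n S ν b a u‖ ≤ ‖(1 / (2 * (π : ℂ) * Complex.I)) ^ 2‖ *
      (2 * (Real.exp (1 / 2) * Real.exp (4 / 3) * (2 * √π))) * Real.exp (-u / D) := by
  have hup : Complex.exp (5 * Complex.I * π / 6) =
      Complex.exp ((1 * (5 * π / 6) : ℝ) * Complex.I) := by
    congr 1
    push_cast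
    ring
  have hdown : Complex.exp (Complex.I * π / 6) =
      -Complex.exp ((-1 * (5 * π / 6) : ℝ) * Complex.I) := by
    rw [← neg_one_mul, ← Complex.exp_pi_mul_I, ← Complex.exp_add]
    congr 1
    push_cast
    ring
  obtain ⟨hint₁, hJ₁⟩ := edgeKernel_ray_bound hn hx hD hD3 hDx hu (σ := 1) (Or.inl rfl)
  obtain ⟨hint₂, hJ₂⟩ := edgeKernel_ray_bound hn hx hD hD3 hDx hu (σ := -1) (Or.inr rfl)
  simp only [edgeI]
  rw [hup, hdown]
  generalize Complex.exp ((1 * (5 * π / 6) : ℝ) * Complex.I) = e₁ at *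
  generalize Complex.exp ((-1 * (5 * π / 6) : ℝ) * Complex.I) = e₂ at *
  set R : ℂ → ℝ → ℂ := fun e r => (∫ s : ℝ, edgeKernel x u (r * e) (s * Complex.I)) * e with hR
  have hkernel : ∀ ζ : ℂ, (∫ s : ℝ,
      Complex.exp ((u : ℂ) * ((b + ζ) - (b + s * Complex.I))) / ((b + s * Complex.I) - (b + ζ)) *
      Complex.exp ((S : ℂ) * ((b + s * Complex.I) ^ 2 - (b + ζ) ^ 2) / 2 -
        (a : ℂ) * (S : ℂ) * ((b + s * Complex.I) - (b + ζ))) *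
      (∏ j, ((S : ℂ) * (b + s * Complex.I) - (ν j : ℂ)) / ((S : ℂ) * (b + ζ) - (ν j : ℂ))) *
      Complex.I) = (∫ s : ℝ, edgeKernel x u ζ (s * Complex.I)) * Complex.I := by
    intro ζ
    rw [← integral_mul_const]
    refine integral_congr_ae (ae_of_all _ fun s => ?_)
    simp only [edge_integrand_eq hS (fun j => (hx j).ne') hν hS2 ha u ζ (s * Complex.I)]
  set G : ℝ → ℂ := fun t => (∫ s : ℝ,
      Complex.exp ((u : ℂ) * ((if t ≤ 0 then (b : ℂ) + t * -e₂ else b + t * e₁) -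
        (b + s * Complex.I))) /
        ((b + s * Complex.I) - (if t ≤ 0 then (b : ℂ) + t * -e₂ else b + t * e₁)) *
      Complex.exp ((S : ℂ) * ((b + s * Complex.I) ^ 2 -
          (if t ≤ 0 then (b : ℂ) + t * -e₂ else b + t * e₁) ^ 2) / 2 -
        (a : ℂ) * (S : ℂ) * ((b + s * Complex.I) -
          (if t ≤ 0 then (b : ℂ) + t * -e₂ else b + t * e₁))) *
      (∏ j, ((S : ℂ) * (b + s * Complex.I) - (ν j : ℂ)) /
        ((S : ℂ) * (if t ≤ 0 then (b : ℂ) + t * -e₂ else b + t * e₁) - (ν j : ℂ))) *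
      Complex.I) * (if t ≤ 0 then -e₂ else e₁) with hG
  have hpos : ∀ t ∈ Ioi (0 : ℝ), G t = Complex.I * R e₁ t := by
    intro t ht
    simp only [hG, hR, if_neg (not_le.2 (mem_Ioi.1 ht))]
    rw [hkernel]
    ring
  have hneg : ∀ t ∈ Iic (0 : ℝ), G t = -Complex.I * R e₂ (-t) := by
    intro t ht
    simp only [hG, hR, if_pos (mem_Iic.1 ht)]
    have hcomm : ∀ A : ℂ, A * Complex.I * -e₂ = -Complex.I * (A * e₂) := fun A => by ring
    rw [hkernel, Complex.ofReal_neg, neg_mul_comm (t : ℂ)]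
    exact hcomm _
  have hiIoi : IntegrableOn G (Ioi 0) :=
    IntegrableOn.congr_fun (hint₁.const_mul Complex.I) (fun t ht => (hpos t ht).symm)
      measurableSet_Ioi
  have hiIic : IntegrableOn G (Iic 0) := by
    have h : IntegrableOn (R e₂) (Ici (-0)) := by
      rw [neg_zero, integrableOn_Ici_iff_integrableOn_Ioi]
      exact hint₂
    exact IntegrableOn.congr_fun (h.comp_neg_Iic.const_mul (-Complex.I))
      (fun t ht => (hneg t ht).symm) measurableSet_Iic
  have hsplit : ∫ t, G t = -Complex.I * (∫ r in Ioi (0 : ℝ), R e₂ r) +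
      Complex.I * ∫ r in Ioi (0 : ℝ), R e₁ r := by
    rw [← intervalIntegral.integral_Iic_add_Ioi hiIic hiIoi,
      setIntegral_congr_fun measurableSet_Iic hneg, setIntegral_congr_fun measurableSet_Ioi hpos,
      integral_const_mul, integral_const_mul, integral_comp_neg_Iic, neg_zero]
  rw [hsplit, norm_mul]
  have htri : ‖-Complex.I * (∫ r in Ioi (0 : ℝ), R e₂ r) +
      Complex.I * ∫ r in Ioi (0 : ℝ), R e₁ r‖ ≤
      ‖∫ r in Ioi (0 : ℝ), R e₂ r‖ + ‖∫ r in Ioi (0 : ℝ), R e₁ r‖ := by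
    refine (norm_add_le _ _).trans (le_of_eq ?_)
    simp
  have hDtri := mul_le_mul_of_nonneg_left htri hD.le
  rw [mul_add] at hDtri
  calc _ = ‖(1 / (2 * (π : ℂ) * Complex.I)) ^ 2‖ * (D * ‖-Complex.I *
        (∫ r in Ioi (0 : ℝ), R e₂ r) + Complex.I * ∫ r in Ioi (0 : ℝ), R e₁ r‖) := by ring
    _ ≤ ‖(1 / (2 * (π : ℂ) * Complex.I)) ^ 2‖ *
        (Real.exp (1 / 2) * Real.exp (4 / 3) * (2 * √π) * Real.exp (-u / D) +
          Real.exp (1 / 2) * Real.exp (4 / 3) * (2 * √π) * Real.exp (-u / D)) := by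
        gcongr
        exact hDtri.trans (add_le_add hJ₂ hJ₁)
    _ = _ := by ring

/-- For all `0 < α₀ < β₀` there are constants `C > 0` and `S₀ > 0`,
depending only on `α₀, β₀`, such that for every `n ≥ 1`, every `S ≥ S₀`, every `ν`
and `b` satisfying the edge conditions (`bS > maxⱼ νⱼ`, `∑ⱼ S/(bS−νⱼ)² = 1`,
`α₀ ≤ b − νⱼ/S ≤ β₀`), and every `ξ ≥ 0`, setting `u = ξ·d·S^{1/3}` with
`d = (∑ⱼ S²/(bS−νⱼ)³)^{1/3}` and `a = b + ∑ⱼ 1/(bS−νⱼ)`: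
`d·S^{1/3}·|I(ξ)| ≤ C·e^{−ξ}`. -/
theorem statement6 (α0 β0 : ℝ) (hα0 : 0 < α0) (hαβ : α0 < β0) :
    ∃ C S0 : ℝ, 0 < C ∧ 0 < S0 ∧
      ∀ (n : ℕ), 1 ≤ n → ∀ S : ℝ, S0 ≤ S → ∀ (ν : Fin n → ℝ) (b : ℝ),
      (∀ j, ν j < b * S) →
      (∑ j, S / (b * S - ν j) ^ 2) = 1 →
      (∀ j, α0 ≤ b - ν j / S ∧ b - ν j / S ≤ β0) →
      ∀ ξ : ℝ, 0 ≤ ξ →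
      (∑ j, S ^ 2 / (b * S - ν j) ^ 3) ^ ((1 : ℝ) / 3) * S ^ ((1 : ℝ) / 3) *
          ‖edgeI n S ν b (b + ∑ j, 1 / (b * S - ν j))
            (ξ * (∑ j, S ^ 2 / (b * S - ν j) ^ 3) ^ ((1 : ℝ) / 3) * S ^ ((1 : ℝ) / 3))‖ ≤
        C * Real.exp (-ξ) := by
  refine ⟨‖(1 / (2 * (π : ℂ) * Complex.I)) ^ 2‖ *
    (2 * (Real.exp (1 / 2) * Real.exp (4 / 3) * (2 * √π))), 8 * β0 / α0 ^ 3, ?_, ?_, ?_⟩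
  · have : (1 / (2 * (π : ℂ) * Complex.I)) ^ 2 ≠ 0 := by simp [Real.pi_ne_zero]
    have := norm_pos_iff.2 this
    have := Real.sqrt_pos.2 Real.pi_pos
    positivity
  · have := hα0.trans hαβ
    positivity
  intro n hn S hS0 ν b _ hsum hαx ξ hξ
  have hβ0 : 0 < β0 := hα0.trans hαβ
  have hS : 0 < S := lt_of_lt_of_le (by positivity) hS0
  obtain ⟨x, hxdef⟩ : ∃ x : Fin n → ℝ, ∀ j, x j = b - ν j / S := ⟨_, fun _ => rfl⟩
  have hxα : ∀ j, α0 ≤ x j := fun j => hxdef j ▸ (hαx j).1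
  have hxβ : ∀ j, x j ≤ β0 := fun j => hxdef j ▸ (hαx j).2
  have hx : ∀ j, 0 < x j := fun j => hα0.trans_le (hxα j)
  have hν : ∀ j, ν j = S * (b - x j) := fun j => by
    rw [hxdef]
    field_simp
    ring
  have hden : ∀ j, b * S - ν j = S * x j := fun j => by rw [hν]; ring
  simp only [hden] at hsum ⊢
  have hS2 : ∑ j, 1 / x j ^ 2 = S := by
    have h : ∑ j, S / (S * x j) ^ 2 = (∑ j, 1 / x j ^ 2) / S := by
      rw [Finset.sum_div]
      refine Finset.sum_congr rfl fun j _ => ?_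
      have := hx j
      field_simp
    rw [h, div_eq_one_iff_eq hS.ne'] at hsum
    exact hsum
  have ha : (b + ∑ j, 1 / (S * x j)) * S = b * S + ∑ j, 1 / x j := by
    rw [add_mul, Finset.sum_mul]
    congr 1
    refine Finset.sum_congr rfl fun j _ => ?_
    have := hx j
    field_simp
  have hd : 0 ≤ ∑ j, S ^ 2 / (S * x j) ^ 3 :=
    Finset.sum_nonneg fun j _ => by have := hx j; positivity
  obtain ⟨D, hDdef⟩ : ∃ D, D = (∑ j, S ^ 2 / (S * x j) ^ 3) ^ ((1 : ℝ) / 3) *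
    S ^ ((1 : ℝ) / 3) := ⟨_, rfl⟩
  have hD0 : 0 ≤ D := by rw [hDdef]; positivity
  have hroot : ∀ {y : ℝ}, 0 ≤ y → (y ^ ((1 : ℝ) / 3)) ^ 3 = y := fun hy => by
    rw [← Real.rpow_natCast, ← Real.rpow_mul hy]
    norm_num
  have hD3 : D ^ 3 = ∑ j, 1 / x j ^ 3 := by
    rw [hDdef, mul_pow, hroot hd, hroot hS.le, Finset.sum_mul]
    refine Finset.sum_congr rfl fun j _ => ?_
    have := hx j
    field_simp
  have hDlow : S / β0 ≤ D ^ 3 := by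
    rw [hD3, ← hS2, Finset.sum_div]
    refine Finset.sum_le_sum fun j _ => ?_
    have := hx j
    rw [div_div, pow_succ (x j) 2]
    exact one_div_le_one_div_of_le (by positivity)
      (mul_le_mul_of_nonneg_left (hxβ j) (by positivity))
  have hDα : 2 / α0 ≤ D := by
    refine le_of_pow_le_pow_left₀ three_ne_zero hD0 (le_trans ?_ hDlow)
    rw [le_div_iff₀ hβ0]
    refine le_trans (le_of_eq ?_) hS0
    field_simp
    norm_num
  have hD : 0 < D := lt_of_lt_of_le (by positivity) hDα
  have hDx : ∀ j, 2 ≤ D * x j := fun j =>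
    ((div_le_iff₀ hα0).1 hDα).trans (mul_le_mul_of_nonneg_left (hxα j) hD0)
  have h := edgeI_bound hn hS.ne' hx hν hS2 ha hD hD3 hDx (mul_nonneg hξ hD0)
  rw [mul_assoc ξ, ← hDdef]
  rwa [neg_div, mul_div_cancel_right₀ _ hD.ne'] at h
end

section
/- Let M be an n×n complex Hermitian matrix, n ≥ 2, and z ∈ ℂ with Im z ≠ 0. Then tr D = Σ_{k=1}^n 1/(M_{kk} − z − α_k* D_k α_k), where all denominators are nonzero. -/
open Matrix
open scoped ComplexOrder

/-- The resolventM `(H − zI)⁻¹` of a square complex matrix. -/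
noncomputable def resolventM {m : ℕ} (H : Matrix (Fin m) (Fin m) ℂ) (z : ℂ) :
    Matrix (Fin m) (Fin m) ℂ :=
  (H - z • (1 : Matrix (Fin m) (Fin m) ℂ))⁻¹

/-- The matrix obtained from `M` by deleting its `k`-th row and `k`-th column. -/
def minorDel {n : ℕ} (M : Matrix (Fin (n + 1)) (Fin (n + 1)) ℂ) (k : Fin (n + 1)) :
    Matrix (Fin n) (Fin n) ℂ :=
  M.submatrix k.succAbove k.succAbove

/-- The `k`-th column of `M` with its `k`-th entry removed. -/
def colDel {n : ℕ} (M : Matrix (Fin (n + 1)) (Fin (n + 1)) ℂ) (k : Fin (n + 1)) :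
    Fin n → ℂ :=
  fun i => M (k.succAbove i) k

theorem Matrix.IsHermitian.isUnit_det_sub_smul_one {m : Type*} [Fintype m] [DecidableEq m]
    {H : Matrix m m ℂ} (hH : H.IsHermitian) {z : ℂ} (hz : z.im ≠ 0) :
    IsUnit (H - z • (1 : Matrix m m ℂ)).det := by
  rw [isUnit_iff_ne_zero]
  intro hdet
  obtain ⟨v, hv, hv0⟩ := Matrix.exists_mulVec_eq_zero_iff.mpr hdet
  have hEig : H *ᵥ v = z • v := by
    rwa [Matrix.sub_mulVec, Matrix.smul_mulVec, Matrix.one_mulVec, sub_eq_zero] at hv0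
  have hquad : (star v ⬝ᵥ (H *ᵥ v)).im = 0 := hH.im_star_dotProduct_mulVec_self v
  have hpos : 0 < star v ⬝ᵥ v := dotProduct_star_self_pos_iff.mpr hv
  obtain ⟨hre, him⟩ := Complex.pos_iff.mp hpos
  rw [hEig, dotProduct_smul, smul_eq_mul, Complex.mul_im, ← him, mul_zero, zero_add] at hquad
  exact mul_ne_zero hz hre.ne' hquad

/-- The Schur complement formula for a diagonal entry of the inverse matrix. -/
theorem Matrix.inv_apply_self_mul_schur_eq_one {n : ℕ} {R : Type*} [CommRing R]
    (A : Matrix (Fin (n + 1)) (Fin (n + 1)) R) (k : Fin (n + 1)) (hA : IsUnit A.det)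
    (hB : IsUnit (A.submatrix k.succAbove k.succAbove).det) :
    A⁻¹ k k * (A k k - (fun i => A k (k.succAbove i)) ⬝ᵥ
      ((A.submatrix k.succAbove k.succAbove)⁻¹ *ᵥ fun i => A (k.succAbove i) k)) = 1 := by
  set B := A.submatrix k.succAbove k.succAbove
  set a : Fin n → R := fun i => A (k.succAbove i) k
  set v : Fin n → R := fun i => A⁻¹ (k.succAbove i) k
  have hmul (i) : A i k * A⁻¹ k k + ∑ j, A i (k.succAbove j) * v j =
      (1 : Matrix (Fin (n + 1)) (Fin (n + 1)) R) i k := by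
    rw [← Matrix.mul_nonsing_inv A hA, Matrix.mul_apply, Fin.sum_univ_succAbove _ k]
  have hBv : B *ᵥ v = -(A⁻¹ k k • a) := by
    ext i
    have h := hmul (k.succAbove i)
    rw [Matrix.one_apply_ne (Fin.succAbove_ne k i), add_comm] at h
    simpa [Matrix.mulVec, dotProduct, B, a, mul_comm] using eq_neg_of_add_eq_zero_left h
  have hv : v = -(A⁻¹ k k • (B⁻¹ *ᵥ a)) := by
    rw [← Matrix.mulVec_smul, ← Matrix.mulVec_neg, ← hBv, Matrix.mulVec_mulVec,
      Matrix.nonsing_inv_mul B hB, Matrix.one_mulVec]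
  have h : A k k * A⁻¹ k k + (fun j => A k (k.succAbove j)) ⬝ᵥ v = 1 := by
    simpa [dotProduct] using hmul k
  rw [hv, dotProduct_neg, dotProduct_smul, smul_eq_mul] at h
  linear_combination h

/-- For an `n×n` Hermitian matrix `M` (`n ≥ 2`) and `z` with `Im z ≠ 0`,
writing `D = (M − zI)⁻¹`, `Dₖ = (Mₖ − zI)⁻¹` (with `Mₖ` the `k`-th principal minor) and
`αₖ` the `k`-th column of `M` with the `k`-th entry removed, all the quantities
`M_{kk} − z − αₖ* Dₖ αₖ` are nonzero and
`tr D = ∑ₖ 1/(M_{kk} − z − αₖ* Dₖ αₖ)`. -/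
theorem statement11 {n : ℕ} (hn : 1 ≤ n)
    (M : Matrix (Fin (n + 1)) (Fin (n + 1)) ℂ) (hM : M.IsHermitian)
    (z : ℂ) (hz : z.im ≠ 0) :
    (∀ k : Fin (n + 1),
      M k k - z - star (colDel M k) ⬝ᵥ (resolventM (minorDel M k) z *ᵥ colDel M k) ≠ 0) ∧
    (resolventM M z).trace =
      ∑ k : Fin (n + 1),
        (M k k - z - star (colDel M k) ⬝ᵥ (resolventM (minorDel M k) z *ᵥ colDel M k))⁻¹ := by
  have key (k : Fin (n + 1)) : resolventM M z k k *
      (M k k - z - star (colDel M k) ⬝ᵥ (resolventM (minorDel M k) z *ᵥ colDel M k)) = 1 := by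
    have hsub : (M - z • (1 : Matrix (Fin (n + 1)) (Fin (n + 1)) ℂ)).submatrix
        k.succAbove k.succAbove = minorDel M k - z • (1 : Matrix (Fin n) (Fin n) ℂ) := by
      ext i j
      simp [minorDel, Matrix.one_apply]
    have hminor : (minorDel M k).IsHermitian := hM.submatrix k.succAbove
    have h := Matrix.inv_apply_self_mul_schur_eq_one
      (M - z • (1 : Matrix (Fin (n + 1)) (Fin (n + 1)) ℂ)) k (hM.isUnit_det_sub_smul_one hz)
      (hsub ▸ hminor.isUnit_det_sub_smul_one hz)
    have hcol : (fun i => (M - z • (1 : Matrix (Fin (n + 1)) (Fin (n + 1)) ℂ))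
        (k.succAbove i) k) = colDel M k := by
      ext i
      simp [colDel]
    have hrow : (fun i => (M - z • (1 : Matrix (Fin (n + 1)) (Fin (n + 1)) ℂ))
        k (k.succAbove i)) = star (colDel M k) := by
      ext i
      simpa [colDel, Matrix.one_apply_ne (Fin.succAbove_ne k i).symm] using
        (hM.apply k (k.succAbove i)).symm
    rw [hsub, hcol, hrow] at h
    simpa [resolventM] using h
  exact ⟨fun k => right_ne_zero_of_mul_eq_one (key k),
    Finset.sum_congr rfl fun k _ => eq_inv_of_mul_eq_one_left (key k)⟩
end

section
/- Let M be an n×n complex Hermitian matrix, n ≥ 2, and z ∈ ℂ with Im z ≠ 0. Then for each k with 1 ≤ k ≤ n, tr D − tr D_k = (1 + α_k* D_k² α_k)/(M_{kk} − z − α_k* D_k α_k), where the denominator is nonzero. -/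
open Matrix

namespace Matrix

variable {m n : Type*} [Fintype m] [Fintype n]

theorem trace_fromBlocks_eq_add {R : Type*} [AddCommMonoid R] (A : Matrix m m R)
    (B : Matrix m n R) (C : Matrix n m R) (D : Matrix n n R) :
    (fromBlocks A B C D).trace = A.trace + D.trace := by
  simp [trace]

variable [DecidableEq m] [DecidableEq n]

open scoped ComplexOrder in
theorem IsHermitian.isUnit_sub_smul_one {H : Matrix m m ℂ} (hH : H.IsHermitian) {z : ℂ}
    (hz : z.im ≠ 0) : IsUnit (H - z • (1 : Matrix m m ℂ)) := by
  rw [isUnit_iff_isUnit_det, isUnit_iff_ne_zero]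
  intro h
  obtain ⟨v, hv, hHv⟩ := exists_mulVec_eq_zero_iff.mpr h
  rw [sub_mulVec, smul_mulVec, one_mulVec, sub_eq_zero] at hHv
  have hreal := hH.im_star_dotProduct_mulVec_self v
  have hpos := dotProduct_star_self_pos_iff.mpr hv
  rw [Complex.lt_def, Complex.zero_re, Complex.zero_im] at hpos
  rw [hHv, dotProduct_smul, smul_eq_mul] at hreal
  change (z * (star v ⬝ᵥ v)).im = 0 at hreal
  rw [Complex.mul_im, ← hpos.2, mul_zero, zero_add] at hreal
  exact (mul_ne_zero hz hpos.1.ne') hreal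

variable {K : Type*} [Field K]

/-- The Schur complement of an invertible block in a bordered matrix is nonzero if the bordered
matrix is invertible, and it determines the difference of the traces of the inverses. -/
theorem trace_inv_fromBlocks_replicateCol (A : Matrix m m K) (b c : m → K) (d : K)
    (hA : IsUnit A)
    (hP : IsUnit (fromBlocks A (replicateCol Unit b) (replicateRow Unit c) (of fun _ _ => d))) :
    d - c ⬝ᵥ (A⁻¹ *ᵥ b) ≠ 0 ∧
    (fromBlocks A (replicateCol Unit b) (replicateRow Unit c) (of fun _ _ => d))⁻¹.trace
        - A⁻¹.trace =
      (1 + c ⬝ᵥ ((A⁻¹ * A⁻¹) *ᵥ b)) / (d - c ⬝ᵥ (A⁻¹ *ᵥ b)) := by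
  have := hA.invertible
  have := hP.invertible
  set s := d - c ⬝ᵥ (A⁻¹ *ᵥ b) with hs
  have hS : (of fun _ _ => d) - replicateRow Unit c * ⅟A * replicateCol Unit b =
      s • (1 : Matrix Unit Unit K) := by
    ext i j
    rw [Matrix.mul_assoc, invOf_eq_nonsing_inv, ← replicateCol_mulVec]
    simp [hs, Matrix.mul_apply, dotProduct]
  have hs0 : s ≠ 0 := by
    intro h0
    have hdet := (isUnit_iff_isUnit_det _).mp hP
    rw [det_fromBlocks₁₁, hS, h0] at hdet
    simp at hdet
  refine ⟨hs0, ?_⟩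
  have : Invertible ((of fun _ _ => d) - replicateRow Unit c * ⅟A * replicateCol Unit b) := by
    rw [hS]
    exact ⟨s⁻¹ • 1, by simp [hs0], by simp [hs0]⟩
  have hSinv : ⅟((of fun _ _ => d) - replicateRow Unit c * ⅟A * replicateCol Unit b) =
      s⁻¹ • (1 : Matrix Unit Unit K) := by
    apply invOf_eq_right_inv
    rw [hS]
    simp [hs0]
  have htr : (A⁻¹ * replicateCol Unit b * (replicateRow Unit c * A⁻¹)).trace =
      c ⬝ᵥ ((A⁻¹ * A⁻¹) *ᵥ b) := by
    rw [trace_mul_comm, Matrix.mul_assoc, ← Matrix.mul_assoc A⁻¹, ← replicateCol_mulVec]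
    simp [trace, Matrix.mul_apply, dotProduct]
  rw [← invOf_eq_nonsing_inv (fromBlocks _ _ _ _), invOf_fromBlocks₁₁_eq, hSinv,
    trace_fromBlocks_eq_add, invOf_eq_nonsing_inv]
  simp only [Matrix.mul_smul, Matrix.smul_mul, Matrix.mul_one, trace_add, trace_smul]
  rw [Matrix.mul_assoc (A⁻¹ * _), htr]
  simp only [trace_one, Fintype.card_punit, smul_eq_mul]
  field_simp
  push_cast
  ring

theorem trace_inv_submatrix_equiv (A : Matrix m m K) (e : n ≃ m) :
    (A.submatrix e e)⁻¹.trace = A⁻¹.trace := by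
  rw [inv_submatrix_equiv]
  exact e.sum_comp fun i => A⁻¹ i i

end Matrix

/-- For an `n×n` Hermitian matrix `M` (`n ≥ 2`) and `z` with `Im z ≠ 0`,
writing `D = (M − zI)⁻¹`, `Dₖ = (Mₖ − zI)⁻¹` (with `Mₖ` the `k`-th principal minor) and
`αₖ` the `k`-th column of `M` with the `k`-th entry removed, for each `k` the quantity
`M_{kk} − z − αₖ* Dₖ αₖ` is nonzero and
`tr D − tr Dₖ = (1 + αₖ* Dₖ² αₖ)/(M_{kk} − z − αₖ* Dₖ αₖ)`. -/
theorem statement12 {n : ℕ} (hn : 1 ≤ n)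
    (M : Matrix (Fin (n + 1)) (Fin (n + 1)) ℂ) (hM : M.IsHermitian)
    (z : ℂ) (hz : z.im ≠ 0) (k : Fin (n + 1)) :
    M k k - z - star (colDel M k) ⬝ᵥ (resolventM (minorDel M k) z *ᵥ colDel M k) ≠ 0 ∧
    (resolventM M z).trace - (resolventM (minorDel M k) z).trace =
      (1 + star (colDel M k) ⬝ᵥ
          ((resolventM (minorDel M k) z * resolventM (minorDel M k) z) *ᵥ colDel M k)) /
        (M k k - z - star (colDel M k) ⬝ᵥ (resolventM (minorDel M k) z *ᵥ colDel M k)) := by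
  let e : Fin n ⊕ Unit ≃ Fin (n + 1) :=
    ((finSuccEquiv' k).trans (Equiv.optionEquivSumPUnit (Fin n))).symm
  have hblocks : (M - z • (1 : Matrix (Fin (n + 1)) (Fin (n + 1)) ℂ)).submatrix e e =
      fromBlocks (minorDel M k - z • 1) (replicateCol Unit (colDel M k))
        (replicateRow Unit (star (colDel M k))) (of fun _ _ => M k k - z) := by
    ext i j
    have hstar (j : Fin n) : star (M (k.succAbove j) k) = M k (k.succAbove j) := hM.apply _ _
    rcases i with i | i <;> rcases j with j | j <;>
      simp_all [e, minorDel, colDel, one_apply, Fin.succAbove_ne, (Fin.succAbove_ne _ _).symm]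
  have hunit := (isUnit_submatrix_equiv e e).mpr (hM.isUnit_sub_smul_one hz)
  rw [hblocks] at hunit
  have hMk : (minorDel M k).IsHermitian := hM.submatrix _
  have key := trace_inv_fromBlocks_replicateCol _ _ _ _ (hMk.isUnit_sub_smul_one hz) hunit
  rwa [← hblocks, trace_inv_submatrix_equiv] at key
end
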